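/- arXiv:1104.0792 — 3 statements merged into one kernel-verified Lean document; each statement's English description precedes it below -/
import Mathlib

section
/- Let Ω ⊂ ℝⁿ be open. Then B̃V^{p(·)}(Ω) equipped with ‖u‖_{B̃V^{p(·)}} := ‖u‖_{p(·)} + inf{λ > 0 : ρ̃_{BV^{p(·)}(Ω)}(u/λ) ≤ 1} is a normed space; in particular this quantity satisfies the triangle inequality, is positively homogeneous, and vanishes exactly when u = 0 in L^{p(·)}(Ω). -/
open MeasureTheory Filter Topology ENNReal Set

noncomputable section

/-- Euclidean space `ℝⁿ`. -/
abbrev Eu (n : ℕ) : Type := EuclideanSpace ℝ (Fin n)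

/-- The modular `ρ_{p(·)}(u) = ∫_Ω |u|^{p(x)} dx`. -/
def vModular {n : ℕ} (p : Eu n → ℝ) (Ω : Set (Eu n)) (u : Eu n → ℝ) : ℝ≥0∞ :=
  ∫⁻ x in Ω, ENNReal.ofReal (|u x| ^ p x)

/-- The gradient modular `∫_Ω |∇u|^{p(x)} dx` (for a.e. differentiable `u`,
`fderiv` is the gradient). -/
def gradModular {n : ℕ} (p : Eu n → ℝ) (Ω : Set (Eu n)) (u : Eu n → ℝ) : ℝ≥0∞ :=
  ∫⁻ x in Ω, ENNReal.ofReal (‖fderiv ℝ u x‖ ^ p x)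

/-- Membership in the variable exponent Lebesgue space `L^{p(·)}(Ω)`. -/
def MemLpVar {n : ℕ} (p : Eu n → ℝ) (Ω : Set (Eu n)) (u : Eu n → ℝ) : Prop :=
  Measurable u ∧ ∃ l : ℝ, 0 < l ∧ vModular p Ω (fun x => u x / l) < ⊤

/-- The Luxemburg norm on `L^{p(·)}(Ω)`. -/
def luxNorm {n : ℕ} (p : Eu n → ℝ) (Ω : Set (Eu n)) (u : Eu n → ℝ) : ℝ :=
  sInf {l : ℝ | 0 < l ∧ vModular p Ω (fun x => u x / l) ≤ 1}

/-- Convergence `v i → u` in `L^{p(·)}(Ω)` (Luxemburg norm convergence). -/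
def LpTendsto {n : ℕ} (p : Eu n → ℝ) (Ω : Set (Eu n)) (v : ℕ → Eu n → ℝ)
    (u : Eu n → ℝ) : Prop :=
  Tendsto (fun i => luxNorm p Ω (fun x => v i x - u x)) atTop (𝓝 0)

/-- `u` is locally Lipschitz on `Ω`. -/
def LocLipOn {n : ℕ} (Ω : Set (Eu n)) (u : Eu n → ℝ) : Prop :=
  ∀ x ∈ Ω, ∃ K : NNReal, ∃ t ∈ 𝓝[Ω] x, LipschitzOnWith K u t

/-- The relaxed mixed pseudo-modular `ρ̃_{BV^{p(·)}(Ω)}(u)`: the infimum of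
`liminf_i ∫_Ω |∇u_i|^{p(x)} dx` over all sequences of locally Lipschitz functions
in `L^{p(·)}(Ω)` converging to `u` in `L^{p(·)}(Ω)`. -/
def bvModular {n : ℕ} (p : Eu n → ℝ) (Ω : Set (Eu n)) (u : Eu n → ℝ) : ℝ≥0∞ :=
  ⨅ (v : ℕ → Eu n → ℝ)
    (_ : (∀ i, LocLipOn Ω (v i) ∧ MemLpVar p Ω (v i)) ∧ LpTendsto p Ω v u),
    Filter.liminf (fun i => gradModular p Ω (v i)) atTop

/-- Membership in the mixed space `B̃V^{p(·)}(Ω)`. -/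
def MemBVt {n : ℕ} (p : Eu n → ℝ) (Ω : Set (Eu n)) (u : Eu n → ℝ) : Prop :=
  MemLpVar p Ω u ∧ bvModular p Ω u < ⊤

/-- The norm `‖u‖_{B̃V^{p(·)}}`. -/
def bvNorm {n : ℕ} (p : Eu n → ℝ) (Ω : Set (Eu n)) (u : Eu n → ℝ) : ℝ :=
  luxNorm p Ω u + sInf {l : ℝ | 0 < l ∧ bvModular p Ω (fun x => u x / l) ≤ 1}

/-- The admissible class `Ã(E)` for the mixed capacity. -/
def admissibleBV {n : ℕ} (p : Eu n → ℝ) (Ω E : Set (Eu n)) : Set (Eu n → ℝ) :=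
  {u | MemBVt p Ω u ∧ (∀ x ∈ Ω, 0 ≤ u x ∧ u x ≤ 1) ∧
       ∃ U : Set (Eu n), IsOpen U ∧ E ⊆ U ∧ ∀ x ∈ U ∩ Ω, u x = 1}

/-- The mixed BV-Sobolev capacity `C̃_{BV^{p(·)}}(E)` (with `inf ∅ = ∞`). -/
def bvCapacity {n : ℕ} (p : Eu n → ℝ) (Ω E : Set (Eu n)) : ℝ≥0∞ :=
  ⨅ (u : Eu n → ℝ) (_ : u ∈ admissibleBV p Ω E), vModular p Ω u + bvModular p Ω u

/-- Divergence of a vector field. -/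
def divg {n : ℕ} (φ : Eu n → Eu n) (x : Eu n) : ℝ :=
  ∑ i, fderiv ℝ φ x (EuclideanSpace.single i 1) i

/-- Total variation `‖Du‖(U)` on an open set `U`, via the defining supremum over
`C¹` vector fields compactly supported in `U` with `|φ| ≤ 1`. -/
def totVarOpen {n : ℕ} (U : Set (Eu n)) (u : Eu n → ℝ) : ℝ≥0∞ :=
  ⨆ (φ : Eu n → Eu n)
    (_ : ContDiff ℝ 1 φ ∧ HasCompactSupport φ ∧ tsupport φ ⊆ U ∧ ∀ x, ‖φ x‖ ≤ 1),
    ENNReal.ofReal (∫ x in U, u x * divg φ x)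

/-- Total variation `‖Du‖(A)` of a set `A ⊆ Ω`, extended from open sets. -/
def totVarIn {n : ℕ} (Ω A : Set (Eu n)) (u : Eu n → ℝ) : ℝ≥0∞ :=
  ⨅ (U : Set (Eu n)) (_ : IsOpen U ∧ A ⊆ U ∧ U ⊆ Ω), totVarOpen U u

/-- `g` is the weak (distributional) gradient of `u` on `Ω`. -/
def IsWeakGrad {n : ℕ} (Ω : Set (Eu n)) (u : Eu n → ℝ) (g : Eu n → Eu n) : Prop :=
  ∀ φ : Eu n → ℝ, ContDiff ℝ 1 φ → HasCompactSupport φ → tsupport φ ⊆ Ω →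
    ∀ i : Fin n,
      (∫ x in Ω, u x * (fderiv ℝ φ x (EuclideanSpace.single i 1))) =
        - ∫ x in Ω, g x i * φ x

/-- The Harjulehto–Hästö–Latvala mixed pseudo-modular
`ρ_{BV^{p(·)}(F)}(u) = ‖Du‖(F ∩ Y) + ∫_{F∖Y} |∇u|^{p(x)} dx`, where `Y = {p = 1}`
and `g` is the weak gradient of `u` on the Sobolev part. -/
def hhlModular {n : ℕ} (p : Eu n → ℝ) (Ω F : Set (Eu n)) (u : Eu n → ℝ)
    (g : Eu n → Eu n) : ℝ≥0∞ :=
  totVarIn Ω (F ∩ {x | p x = 1}) u +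
    ∫⁻ x in F \ {x | p x = 1}, ENNReal.ofReal (‖g x‖ ^ p x)

/-- The HHL mixed pseudo-modular for (smooth) functions whose gradient is `fderiv`. -/
def hhlModularSmooth {n : ℕ} (p : Eu n → ℝ) (Ω F : Set (Eu n)) (v : Eu n → ℝ) : ℝ≥0∞ :=
  totVarIn Ω (F ∩ {x | p x = 1}) v +
    ∫⁻ x in F \ {x | p x = 1}, ENNReal.ofReal (‖fderiv ℝ v x‖ ^ p x)

/-- Membership in the HHL space `BV^{p(·)}(Ω)`: `u ∈ L^{p(·)}(Ω)` and
`inf{λ > 0 : ρ_{BV^{p(·)}(Ω)}(u/λ) ≤ 1} < ∞`. -/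
def MemBVp {n : ℕ} (p : Eu n → ℝ) (Ω : Set (Eu n)) (u : Eu n → ℝ) : Prop :=
  MemLpVar p Ω u ∧
    ∃ g : Eu n → Eu n, IsWeakGrad (Ω \ {x | p x = 1}) u g ∧
      ∃ l : ℝ, 0 < l ∧
        hhlModular p Ω Ω (fun x => u x / l) (fun x => l⁻¹ • g x) ≤ 1

/-- Mollification `u_δ = φ_δ ∗ u` (with `u` extended by zero outside `Ω`),
where `φ_δ(z) = δ^{-n} φ(z/δ)`. -/
def mollify {n : ℕ} (Ω : Set (Eu n)) (u : Eu n → ℝ) (φ : Eu n → ℝ) (δ : ℝ)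
    (x : Eu n) : ℝ :=
  ∫ y in Ω, (δ ^ n)⁻¹ * φ (δ⁻¹ • (x - y)) * u y

/-- `p` is (locally) log-Hölder continuous on `Ω` with constant `c`. -/
def LogHolderOn {n : ℕ} (c : ℝ) (Ω : Set (Eu n)) (p : Eu n → ℝ) : Prop :=
  ∀ x ∈ Ω, ∀ y ∈ Ω, |p x - p y| ≤ c / Real.log (Real.exp 1 + 1 / dist x y)

/-- `p` is globally log-Hölder continuous on `ℝⁿ` with constant `c`. -/
def LogHolderGlobal {n : ℕ} (c : ℝ) (p : Eu n → ℝ) : Prop :=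
  LogHolderOn c Set.univ p ∧
    ∃ pinf : ℝ, 1 ≤ pinf ∧ ∀ x, |p x - pinf| ≤ c / Real.log (Real.exp 1 + ‖x‖)

/-- The variable exponent Sobolev capacity `C_{p(·)}(E)`: infimum of
`∫ |u|^{p(x)} + |∇u|^{p(x)} dx` over `u ∈ W^{1,p(·)}(ℝⁿ)` with `u ≥ 1` on an
open set containing `E`. -/
def sobolevCapacity {n : ℕ} (p : Eu n → ℝ) (E : Set (Eu n)) : ℝ≥0∞ :=
  ⨅ (u : Eu n → ℝ) (g : Eu n → Eu n)
    (_ : MemLpVar p Set.univ u ∧ IsWeakGrad Set.univ u g ∧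
         MemLpVar p Set.univ (fun x => ‖g x‖) ∧
         ∃ U : Set (Eu n), IsOpen U ∧ E ⊆ U ∧ ∀ x ∈ U, 1 ≤ u x),
    vModular p Set.univ u + ∫⁻ x, ENNReal.ofReal (‖g x‖ ^ p x)

section BVHelpers

theorem pw_convex {q a b s t : ℝ} (hq : 1 ≤ q) (ha : 0 ≤ a) (hb : 0 ≤ b) (hs : 0 ≤ s)
    (ht : 0 ≤ t) (hst : s + t = 1) : (s * a + t * b) ^ q ≤ s * a ^ q + t * b ^ q := by
  have := (convexOn_rpow hq).2 (Set.mem_Ici.2 ha) (Set.mem_Ici.2 hb) hs ht hst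
  simpa [smul_eq_mul] using this

theorem int_comb {n : ℕ} {p : Eu n → ℝ} {Ω : Set (Eu n)} (hΩ : IsOpen Ω)
    (hpm : Measurable p) (hp1 : ∀ x ∈ Ω, 1 ≤ p x) {f g h : Eu n → ℝ} (hf : Measurable f)
    (hg : Measurable g)
    (hf0 : ∀ x, 0 ≤ f x) (hg0 : ∀ x, 0 ≤ g x) (hh0 : ∀ x, 0 ≤ h x) {s t : ℝ}
    (hs : 0 ≤ s) (ht : 0 ≤ t) (hst : s + t = 1)
    (hle : ∀ᵐ x ∂(volume.restrict Ω), h x ≤ s * f x + t * g x) :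
    ∫⁻ x in Ω, ENNReal.ofReal (h x ^ p x) ≤
      ENNReal.ofReal s * (∫⁻ x in Ω, ENNReal.ofReal (f x ^ p x)) +
      ENNReal.ofReal t * ∫⁻ x in Ω, ENNReal.ofReal (g x ^ p x) := by
  have mf : Measurable (fun x => ENNReal.ofReal (f x ^ p x)) :=
    (hf.pow hpm).ennreal_ofReal
  have mg : Measurable (fun x => ENNReal.ofReal (g x ^ p x)) :=
    (hg.pow hpm).ennreal_ofReal
  rw [← lintegral_const_mul _ mf, ← lintegral_const_mul _ mg,
    ← lintegral_add_left (mf.const_mul _)]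
  apply lintegral_mono_ae
  filter_upwards [hle, ae_restrict_mem hΩ.measurableSet] with x hx hxΩ
  have hq := hp1 x hxΩ
  rw [← ENNReal.ofReal_mul hs, ← ENNReal.ofReal_mul ht, ← ENNReal.ofReal_add
    (mul_nonneg hs (Real.rpow_nonneg (hf0 x) _)) (mul_nonneg ht (Real.rpow_nonneg (hg0 x) _))]
  apply ENNReal.ofReal_le_ofReal
  exact (Real.rpow_le_rpow (hh0 x) hx (by linarith)).trans
    (pw_convex hq (hf0 x) (hg0 x) hs ht hst)

theorem int_zero {n : ℕ} {p : Eu n → ℝ} {Ω : Set (Eu n)} (hΩ : IsOpen Ω)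
    (hp1 : ∀ x ∈ Ω, 1 ≤ p x) {f : Eu n → ℝ}
    (hf : ∀ᵐ x ∂(volume.restrict Ω), f x = 0) :
    ∫⁻ x in Ω, ENNReal.ofReal (f x ^ p x) = 0 := by
  have : ∫⁻ x in Ω, ENNReal.ofReal (f x ^ p x) = ∫⁻ x in Ω, 0 := by
    apply lintegral_congr_ae
    filter_upwards [hf, ae_restrict_mem hΩ.measurableSet] with x hx hxΩ
    have hq := hp1 x hxΩ
    rw [hx, Real.zero_rpow (by linarith)]
    simp
  simpa using this

theorem int_smul {n : ℕ} {p : Eu n → ℝ} {Ω : Set (Eu n)} (hΩ : IsOpen Ω)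
    (hpm : Measurable p) (hp1 : ∀ x ∈ Ω, 1 ≤ p x) {f h : Eu n → ℝ} (hf : Measurable f)
    (hf0 : ∀ x, 0 ≤ f x) (hh0 : ∀ x, 0 ≤ h x) {s : ℝ}
    (hs : 0 ≤ s) (hs1 : s ≤ 1)
    (hle : ∀ x, h x ≤ s * f x) :
    ∫⁻ x in Ω, ENNReal.ofReal (h x ^ p x) ≤
      ENNReal.ofReal s * ∫⁻ x in Ω, ENNReal.ofReal (f x ^ p x) := by
  have := int_comb (g := fun _ => 0) hΩ hpm hp1 hf measurable_const hf0 (fun _ => le_rfl) hh0 hs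
    (sub_nonneg.2 hs1) (by ring) (Eventually.of_forall fun x => by simpa using hle x)
  rwa [int_zero (f := fun _ => 0) hΩ hp1 (Eventually.of_forall fun x => rfl), mul_zero,
    add_zero] at this

theorem vMod_comb {n : ℕ} {p : Eu n → ℝ} {Ω : Set (Eu n)} (hΩ : IsOpen Ω)
    (hpm : Measurable p) (hp1 : ∀ x ∈ Ω, 1 ≤ p x) {f g : Eu n → ℝ} (hf : Measurable f)
    (hg : Measurable g) {s t : ℝ}
    (hs : 0 ≤ s) (ht : 0 ≤ t) (hst : s + t = 1) :
    vModular p Ω (fun x => s * f x + t * g x) ≤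
      ENNReal.ofReal s * vModular p Ω f + ENNReal.ofReal t * vModular p Ω g := by
  refine int_comb (f := fun x => |f x|) (g := fun x => |g x|) (h := fun x => |s * f x + t * g x|) hΩ hpm hp1 (by fun_prop)
    (by fun_prop) (fun _ => abs_nonneg _)
    (fun _ => abs_nonneg _) (fun _ => abs_nonneg _) hs ht hst (Eventually.of_forall fun x => ?_)
  refine (abs_add_le _ _).trans ?_
  rw [abs_mul, abs_mul, abs_of_nonneg hs, abs_of_nonneg ht]

theorem vMod_smul {n : ℕ} {p : Eu n → ℝ} {Ω : Set (Eu n)} (hΩ : IsOpen Ω)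
    (hpm : Measurable p) (hp1 : ∀ x ∈ Ω, 1 ≤ p x) {f : Eu n → ℝ} (hf : Measurable f)
    {c : ℝ} (hc : |c| ≤ 1) :
    vModular p Ω (fun x => c * f x) ≤ ENNReal.ofReal |c| * vModular p Ω f := by
  refine int_smul (f := fun x => |f x|) (h := fun x => |c * f x|) hΩ hpm hp1 (by fun_prop) (fun _ => abs_nonneg _)
    (fun _ => abs_nonneg _) (abs_nonneg _) hc (fun x => ?_)
  rw [abs_mul]

theorem locLip_ae_diff {n : ℕ} {Ω : Set (Eu n)} (hΩ : IsOpen Ω) {u : Eu n → ℝ}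
    (hu : LocLipOn Ω u) : ∀ᵐ x ∂(volume.restrict Ω), DifferentiableAt ℝ u x := by
  rw [ae_restrict_iff' hΩ.measurableSet, ae_iff]
  apply measure_null_of_locally_null
  intro x hx
  have hxΩ : x ∈ Ω := by
    by_contra h
    exact hx (fun h' => absurd h' h)
  obtain ⟨K, t, ht, hL⟩ := hu x hxΩ
  rw [hΩ.nhdsWithin_eq hxΩ] at ht
  obtain ⟨o, hot, ho, hxo⟩ := mem_nhds_iff.1 ht
  have h := (hL.mono hot).ae_differentiableWithinAt_of_mem (μ := (volume : Measure (Eu n)))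
  refine ⟨_, inter_mem_nhdsWithin _ (ho.mem_nhds hxo), ?_⟩
  rw [ae_iff] at h
  refine measure_mono_null ?_ h
  rintro y ⟨hy, hyo⟩ h'
  exact hy fun _ => (h' hyo).differentiableAt (ho.mem_nhds hyo)

theorem locLip_comb {n : ℕ} {Ω : Set (Eu n)} {u v : Eu n → ℝ}
    (hu : LocLipOn Ω u) (hv : LocLipOn Ω v) (s t : ℝ) :
    LocLipOn Ω (fun x => s * u x + t * v x) := by
  intro x hx
  obtain ⟨K, a, ha, hK⟩ := hu x hx
  obtain ⟨L, b, hb, hL⟩ := hv x hx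
  refine ⟨‖s‖₊ * K + ‖t‖₊ * L, a ∩ b, inter_mem ha hb, ?_⟩
  apply LipschitzOnWith.of_dist_le_mul
  intro y hy z hz
  have h1 := hK.dist_le_mul y hy.1 z hz.1
  have h2 := hL.dist_le_mul y hy.2 z hz.2
  rw [Real.dist_eq] at h1 h2 ⊢
  have : s * u y + t * v y - (s * u z + t * v z) = s * (u y - u z) + t * (v y - v z) := by ring
  rw [this]
  refine (abs_add_le _ _).trans ?_
  rw [abs_mul, abs_mul]
  push_cast
  rw [Real.norm_eq_abs, Real.norm_eq_abs]
  nlinarith [abs_nonneg s, abs_nonneg t, mul_le_mul_of_nonneg_left h1 (abs_nonneg s),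
    mul_le_mul_of_nonneg_left h2 (abs_nonneg t)]

theorem locLip_zero {n : ℕ} {Ω : Set (Eu n)} : LocLipOn Ω (fun _ => (0 : ℝ)) :=
  fun _ _ => ⟨0, univ, univ_mem, by
    apply LipschitzOnWith.of_dist_le_mul
    intro y _ z _
    simp⟩

theorem locLip_smul {n : ℕ} {Ω : Set (Eu n)} {u : Eu n → ℝ}
    (hu : LocLipOn Ω u) (s : ℝ) : LocLipOn Ω (fun x => s * u x) := by
  simpa using locLip_comb hu locLip_zero s 0

theorem measurable_nfderiv {n : ℕ} (u : Eu n → ℝ) : Measurable (fun x => ‖fderiv ℝ u x‖) :=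
  (measurable_fderiv ℝ u).norm

theorem gMod_comb {n : ℕ} {p : Eu n → ℝ} {Ω : Set (Eu n)} (hΩ : IsOpen Ω)
    (hpm : Measurable p) (hp1 : ∀ x ∈ Ω, 1 ≤ p x) {f g : Eu n → ℝ} (hf : LocLipOn Ω f)
    (hg : LocLipOn Ω g) {s t : ℝ}
    (hs : 0 ≤ s) (ht : 0 ≤ t) (hst : s + t = 1) :
    gradModular p Ω (fun x => s * f x + t * g x) ≤
      ENNReal.ofReal s * gradModular p Ω f + ENNReal.ofReal t * gradModular p Ω g := by
  refine int_comb (f := fun x => ‖fderiv ℝ f x‖) (g := fun x => ‖fderiv ℝ g x‖)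
    (h := fun x => ‖fderiv ℝ (fun x => s * f x + t * g x) x‖) hΩ hpm hp1
    (measurable_nfderiv f) (measurable_nfderiv g) (fun _ => norm_nonneg _)
    (fun _ => norm_nonneg _) (fun _ => norm_nonneg _) hs ht hst ?_
  filter_upwards [locLip_ae_diff hΩ hf, locLip_ae_diff hΩ hg] with x hx hy
  have h : HasFDerivAt (fun x => s * f x + t * g x) (s • fderiv ℝ f x + t • fderiv ℝ g x) x :=
    (hx.hasFDerivAt.const_mul s).add (hy.hasFDerivAt.const_mul t)
  rw [h.fderiv]
  refine (norm_add_le _ _).trans ?_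
  rw [norm_smul, norm_smul, Real.norm_of_nonneg hs, Real.norm_of_nonneg ht]

theorem gMod_smul {n : ℕ} {p : Eu n → ℝ} {Ω : Set (Eu n)} (hΩ : IsOpen Ω)
    (hpm : Measurable p) (hp1 : ∀ x ∈ Ω, 1 ≤ p x) (f : Eu n → ℝ)
    {c : ℝ} (hc : |c| ≤ 1) :
    gradModular p Ω (fun x => c * f x) ≤ ENNReal.ofReal |c| * gradModular p Ω f := by
  refine int_smul (f := fun x => ‖fderiv ℝ f x‖)
    (h := fun x => ‖fderiv ℝ (fun x => c * f x) x‖) hΩ hpm hp1 (measurable_nfderiv f)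
    (fun _ => norm_nonneg _) (fun _ => norm_nonneg _) (abs_nonneg _) hc (fun x => ?_)
  have : fderiv ℝ (fun x => c * f x) x = c • fderiv ℝ f x := by
    exact congrFun (fderiv_const_smul_field (𝕜 := ℝ) (f := f) c) x
  rw [this, norm_smul, Real.norm_eq_abs]

/-! Generic Luxemburg functional. -/

def lnorm {n : ℕ} (ρ : (Eu n → ℝ) → ℝ≥0∞) (u : Eu n → ℝ) : ℝ :=
  sInf {l : ℝ | 0 < l ∧ ρ (fun x => u x / l) ≤ 1}

theorem lnorm_nonneg {n : ℕ} (ρ : (Eu n → ℝ) → ℝ≥0∞) (u : Eu n → ℝ) : 0 ≤ lnorm ρ u :=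
  Real.sInf_nonneg fun _ hl => hl.1.le

theorem lnorm_zero_of {n : ℕ} {ρ : (Eu n → ℝ) → ℝ≥0∞} {u : Eu n → ℝ}
    (h : ∀ l : ℝ, 0 < l → ρ (fun x => u x / l) ≤ 1) : lnorm ρ u = 0 := by
  refine le_antisymm ?_ (lnorm_nonneg ρ u)
  refine le_of_forall_pos_le_add fun ε hε => ?_
  rw [zero_add]
  exact csInf_le ⟨0, fun _ hl => hl.1.le⟩ ⟨hε, h ε hε⟩

theorem lnorm_add {n : ℕ} {ρ : (Eu n → ℝ) → ℝ≥0∞} {u v : Eu n → ℝ}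
    (hu : ∃ l : ℝ, 0 < l ∧ ρ (fun x => u x / l) ≤ 1)
    (hv : ∃ l : ℝ, 0 < l ∧ ρ (fun x => v x / l) ≤ 1)
    (h : ∀ a b : ℝ, 0 < a → 0 < b → ρ (fun x => u x / a) ≤ 1 → ρ (fun x => v x / b) ≤ 1 →
      ρ (fun x => (u x + v x) / (a + b)) ≤ 1) :
    lnorm ρ (fun x => u x + v x) ≤ lnorm ρ u + lnorm ρ v := by
  refine le_of_forall_pos_le_add fun ε hε => ?_
  obtain ⟨a, ha, hal⟩ := Real.lt_sInf_add_pos (s := {l : ℝ | 0 < l ∧ ρ (fun x => u x / l) ≤ 1})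
    hu (half_pos hε)
  obtain ⟨b, hb, hbl⟩ := Real.lt_sInf_add_pos (s := {l : ℝ | 0 < l ∧ ρ (fun x => v x / l) ≤ 1})
    hv (half_pos hε)
  have h1 : lnorm ρ (fun x => u x + v x) ≤ a + b :=
    csInf_le ⟨0, fun _ hl => hl.1.le⟩ ⟨add_pos ha.1 hb.1, h a b ha.1 hb.1 ha.2 hb.2⟩
  change a < lnorm ρ u + ε / 2 at hal
  change b < lnorm ρ v + ε / 2 at hbl
  linarith

theorem lnorm_mul {n : ℕ} {ρ : (Eu n → ℝ) → ℝ≥0∞} (h0 : ρ (fun _ => 0) ≤ 1)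
    (hneg : ∀ u : Eu n → ℝ, ρ (fun x => - u x) = ρ u) (u : Eu n → ℝ) (c : ℝ) :
    lnorm ρ (fun x => c * u x) = |c| * lnorm ρ u := by
  by_cases hc : c = 0
  · subst hc
    rw [abs_zero, zero_mul]
    exact lnorm_zero_of fun l hl => by simpa using h0
  have hc' : 0 < |c| := abs_pos.2 hc
  have key : ∀ l : ℝ, ρ (fun x => c * u x / l) = ρ (fun x => u x / (l / |c|)) := by
    intro l
    rcases lt_or_gt_of_ne hc with h | h
    · rw [← hneg (fun x => u x / (l / |c|)), abs_of_neg h]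
      congr 1
      funext x
      rw [div_div_eq_mul_div]
      ring
    · rw [abs_of_pos h]
      congr 1
      funext x
      rw [div_div_eq_mul_div]
      ring
  unfold lnorm
  rw [← smul_eq_mul, ← Real.sInf_smul_of_nonneg hc'.le]
  congr 1
  ext l
  rw [Set.mem_smul_set_iff_inv_smul_mem₀ hc'.ne']
  simp only [Set.mem_ofPred_eq, smul_eq_mul, key]
  rw [inv_mul_eq_div]
  constructor
  · rintro ⟨h1, h2⟩
    exact ⟨div_pos h1 hc', h2⟩
  · rintro ⟨h1, h2⟩
    exact ⟨by rwa [div_pos_iff_of_pos_right hc'] at h1, h2⟩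

theorem exists_scale {c : ℝ≥0∞} (hc : c < ⊤) :
    ∃ l : ℝ, 1 ≤ l ∧ ENNReal.ofReal |l⁻¹| * c ≤ 1 := by
  refine ⟨max 1 c.toReal, le_max_left _ _, ?_⟩
  have hpos : 0 < max 1 c.toReal := lt_of_lt_of_le one_pos (le_max_left _ _)
  have e : ENNReal.ofReal |(max 1 c.toReal)⁻¹| * c =
      ENNReal.ofReal ((max 1 c.toReal)⁻¹ * c.toReal) := by
    rw [abs_of_pos (inv_pos.2 hpos), ENNReal.ofReal_mul (inv_pos.2 hpos).le,
      ENNReal.ofReal_toReal hc.ne]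
  rw [e, ← ENNReal.ofReal_one]
  apply ENNReal.ofReal_le_ofReal
  rw [inv_mul_le_iff₀ hpos, mul_one]
  exact le_max_right _ _

theorem abs_inv_le {l : ℝ} (h : 1 ≤ l) : |l⁻¹| ≤ 1 := by
  rw [abs_of_pos (inv_pos.2 (by linarith))]
  exact inv_le_one_of_one_le₀ h

variable {n : ℕ} {p : Eu n → ℝ} {Ω : Set (Eu n)}

theorem vMod_zero_of (hΩ : IsOpen Ω) (hp1 : ∀ x ∈ Ω, 1 ≤ p x) {u : Eu n → ℝ}
    (hu : ∀ᵐ x ∂(volume.restrict Ω), u x = 0) : vModular p Ω u = 0 :=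
  int_zero (f := fun x => |u x|) hΩ hp1 (hu.mono fun x hx => by simp [hx])

theorem memLp_le_one (hΩ : IsOpen Ω) (hpm : Measurable p) (hp1 : ∀ x ∈ Ω, 1 ≤ p x)
    {u : Eu n → ℝ} (hu : MemLpVar p Ω u) :
    ∃ l : ℝ, 0 < l ∧ vModular p Ω (fun x => u x / l) ≤ 1 := by
  obtain ⟨hm, l, hl, hfin⟩ := hu
  obtain ⟨k, hk, hk1⟩ := exists_scale hfin
  refine ⟨l * k, mul_pos hl (by linarith), ?_⟩
  have := vMod_smul hΩ hpm hp1 (hm.div_const l) (abs_inv_le hk)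
  refine le_trans (le_of_eq ?_) (this.trans hk1)
  congr 1
  funext x
  rw [← div_div, inv_mul_eq_div]

theorem vMod_add_le (hΩ : IsOpen Ω) (hpm : Measurable p) (hp1 : ∀ x ∈ Ω, 1 ≤ p x)
    {u v : Eu n → ℝ} (hu : Measurable u) (hv : Measurable v) (a b : ℝ) (ha : 0 < a) (hb : 0 < b)
    (h1 : vModular p Ω (fun x => u x / a) ≤ 1) (h2 : vModular p Ω (fun x => v x / b) ≤ 1) :
    vModular p Ω (fun x => (u x + v x) / (a + b)) ≤ 1 := by
  have hs : a / (a + b) + b / (a + b) = 1 := by rw [← add_div]; exact div_self (by positivity)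
  have := vMod_comb hΩ hpm hp1 (hu.div_const a) (hv.div_const b)
    (by positivity : 0 ≤ a / (a + b)) (by positivity : 0 ≤ b / (a + b)) hs
  have e : (fun x => (u x + v x) / (a + b)) =
      fun x => a / (a + b) * (u x / a) + b / (a + b) * (v x / b) := by
    funext x
    have : a + b ≠ 0 := by positivity
    field_simp
  rw [e]
  refine this.trans ((add_le_add (mul_le_mul_right h1 _) (mul_le_mul_right h2 _)).trans ?_)
  rw [mul_one, mul_one, ← ENNReal.ofReal_add (by positivity) (by positivity), hs,
    ENNReal.ofReal_one]

theorem memLp_add (hΩ : IsOpen Ω) (hpm : Measurable p) (hp1 : ∀ x ∈ Ω, 1 ≤ p x)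
    {u v : Eu n → ℝ} (hu : MemLpVar p Ω u) (hv : MemLpVar p Ω v) :
    MemLpVar p Ω (fun x => u x + v x) := by
  obtain ⟨a, ha, h1⟩ := memLp_le_one hΩ hpm hp1 hu
  obtain ⟨b, hb, h2⟩ := memLp_le_one hΩ hpm hp1 hv
  exact ⟨hu.1.add hv.1, a + b, add_pos ha hb,
    (vMod_add_le hΩ hpm hp1 hu.1 hv.1 a b ha hb h1 h2).trans_lt one_lt_top⟩

theorem memLp_zero (hΩ : IsOpen Ω) (hp1 : ∀ x ∈ Ω, 1 ≤ p x) :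
    MemLpVar p Ω (fun _ => 0) :=
  ⟨measurable_const, 1, one_pos, by
    rw [vMod_zero_of hΩ hp1 (Eventually.of_forall fun x => by simp)]
    exact zero_lt_top⟩

theorem memLp_mul (hΩ : IsOpen Ω) (hp1 : ∀ x ∈ Ω, 1 ≤ p x)
    {u : Eu n → ℝ} (hu : MemLpVar p Ω u) (c : ℝ) : MemLpVar p Ω (fun x => c * u x) := by
  by_cases hc : c = 0
  · subst hc
    simpa using memLp_zero hΩ hp1
  obtain ⟨hm, l, hl, hfin⟩ := hu
  refine ⟨hm.const_mul c, |c| * l, mul_pos (abs_pos.2 hc) hl, ?_⟩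
  convert hfin using 1
  unfold vModular
  congr 1
  funext x
  have : |c| ≠ 0 := abs_ne_zero.2 hc
  rw [abs_div, abs_mul, abs_mul, abs_abs, mul_div_mul_left _ _ this, abs_div]

theorem memLp_sub (hΩ : IsOpen Ω) (hpm : Measurable p) (hp1 : ∀ x ∈ Ω, 1 ≤ p x)
    {u v : Eu n → ℝ} (hu : MemLpVar p Ω u) (hv : MemLpVar p Ω v) :
    MemLpVar p Ω (fun x => u x - v x) := by
  have := memLp_add hΩ hpm hp1 hu (memLp_mul hΩ hp1 hv (-1))
  convert this using 2
  ring

theorem lux_add (hΩ : IsOpen Ω) (hpm : Measurable p) (hp1 : ∀ x ∈ Ω, 1 ≤ p x)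
    {u v : Eu n → ℝ} (hu : MemLpVar p Ω u) (hv : MemLpVar p Ω v) :
    luxNorm p Ω (fun x => u x + v x) ≤ luxNorm p Ω u + luxNorm p Ω v :=
  lnorm_add (ρ := vModular p Ω) (memLp_le_one hΩ hpm hp1 hu) (memLp_le_one hΩ hpm hp1 hv)
    (vMod_add_le hΩ hpm hp1 hu.1 hv.1)

theorem lux_mul (hΩ : IsOpen Ω) (hp1 : ∀ x ∈ Ω, 1 ≤ p x)
    (u : Eu n → ℝ) (c : ℝ) : luxNorm p Ω (fun x => c * u x) = |c| * luxNorm p Ω u := by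
  refine lnorm_mul (ρ := vModular p Ω) ?_ ?_ u c
  · rw [vMod_zero_of hΩ hp1 (Eventually.of_forall fun x => rfl)]
    exact zero_le_one
  · intro u
    simp [vModular]

theorem lux_zero_of (hΩ : IsOpen Ω) (hp1 : ∀ x ∈ Ω, 1 ≤ p x) {u : Eu n → ℝ}
    (hu : ∀ᵐ x ∂(volume.restrict Ω), u x = 0) : luxNorm p Ω u = 0 :=
  lnorm_zero_of (ρ := vModular p Ω) fun l _ => by
    rw [vMod_zero_of hΩ hp1 (hu.mono fun x hx => by simp [hx])]
    exact zero_le_one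

theorem lpTendsto_mul (hΩ : IsOpen Ω) (hp1 : ∀ x ∈ Ω, 1 ≤ p x)
    {v : ℕ → Eu n → ℝ} {u : Eu n → ℝ} (h : LpTendsto p Ω v u) (c : ℝ) :
    LpTendsto p Ω (fun i x => c * v i x) (fun x => c * u x) := by
  unfold LpTendsto at *
  have := h.const_mul |c|
  rw [mul_zero] at this
  refine this.congr fun i => ?_
  rw [← lux_mul hΩ hp1]
  congr 1
  funext x
  ring

theorem lpTendsto_add (hΩ : IsOpen Ω) (hpm : Measurable p) (hp1 : ∀ x ∈ Ω, 1 ≤ p x)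
    {v w : ℕ → Eu n → ℝ} {f g : Eu n → ℝ} (hv : ∀ i, MemLpVar p Ω (v i))
    (hw : ∀ i, MemLpVar p Ω (w i)) (hf : MemLpVar p Ω f) (hg : MemLpVar p Ω g)
    (h : LpTendsto p Ω v f) (h' : LpTendsto p Ω w g) :
    LpTendsto p Ω (fun i x => v i x + w i x) (fun x => f x + g x) := by
  unfold LpTendsto at *
  have := h.add h'
  rw [add_zero] at this
  refine squeeze_zero (fun i => lnorm_nonneg (vModular p Ω) _) (fun i => ?_) this
  refine le_trans (le_of_eq ?_) (lux_add hΩ hpm hp1 (memLp_sub hΩ hpm hp1 (hv i) hf)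
    (memLp_sub hΩ hpm hp1 (hw i) hg))
  congr 1
  funext x
  ring

theorem bvMod_seq {u : Eu n → ℝ} {c : ℝ≥0∞} (h : bvModular p Ω u < c) :
    ∃ v : ℕ → Eu n → ℝ, (∀ i, LocLipOn Ω (v i)) ∧ (∀ i, MemLpVar p Ω (v i)) ∧
      LpTendsto p Ω v u ∧ ∀ i, gradModular p Ω (v i) ≤ c := by
  unfold bvModular at h
  simp only [iInf_lt_iff] at h
  obtain ⟨v, ⟨hv, hvt⟩, hlt⟩ := h
  obtain ⟨φ, hφ, hφc⟩ := extraction_of_frequently_atTop (frequently_lt_of_liminf_lt (h := hlt))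
  exact ⟨fun i => v (φ i), fun i => (hv _).1, fun i => (hv _).2,
    hvt.comp hφ.tendsto_atTop, fun i => (hφc i).le⟩

theorem bvMod_le {u : Eu n → ℝ} {c : ℝ≥0∞} (v : ℕ → Eu n → ℝ)
    (h1 : ∀ i, LocLipOn Ω (v i)) (h2 : ∀ i, MemLpVar p Ω (v i))
    (h3 : LpTendsto p Ω v u) (h4 : ∀ i, gradModular p Ω (v i) ≤ c) :
    bvModular p Ω u ≤ c := by
  refine (iInf₂_le v ⟨fun i => ⟨h1 i, h2 i⟩, h3⟩).trans ?_
  refine (liminf_le_liminf (Eventually.of_forall h4)).trans ?_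
  simp

theorem bvMod_smul (hΩ : IsOpen Ω) (hpm : Measurable p) (hp1 : ∀ x ∈ Ω, 1 ≤ p x)
    {u : Eu n → ℝ} {C : ℝ≥0∞} (h : bvModular p Ω u < C) {c : ℝ} (hc : |c| ≤ 1) :
    bvModular p Ω (fun x => c * u x) ≤ ENNReal.ofReal |c| * C := by
  obtain ⟨v, h1, h2, h3, h4⟩ := bvMod_seq h
  exact bvMod_le (fun i x => c * v i x) (fun i => locLip_smul (h1 i) c)
    (fun i => memLp_mul hΩ hp1 (h2 i) c) (lpTendsto_mul hΩ hp1 h3 c)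
    (fun i => (gMod_smul hΩ hpm hp1 (v i) hc).trans (mul_le_mul_right (h4 i) _))

theorem bvMod_neg (hΩ : IsOpen Ω) (hpm : Measurable p) (hp1 : ∀ x ∈ Ω, 1 ≤ p x)
    (u : Eu n → ℝ) : bvModular p Ω (fun x => - u x) = bvModular p Ω u := by
  have key : ∀ u : Eu n → ℝ, bvModular p Ω (fun x => - u x) ≤ bvModular p Ω u := by
    intro u
    refine le_of_forall_gt_imp_ge_of_dense fun C hC => ?_
    have := bvMod_smul hΩ hpm hp1 hC (c := -1) (by simp)
    simpa using this
  refine le_antisymm (key u) ?_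
  simpa using key (fun x => - u x)

theorem bvMod_zero_of (hΩ : IsOpen Ω) (hp1 : ∀ x ∈ Ω, 1 ≤ p x) {u : Eu n → ℝ}
    (hu : ∀ᵐ x ∂(volume.restrict Ω), u x = 0) : bvModular p Ω u = 0 := by
  refine le_antisymm ?_ zero_le
  refine bvMod_le (fun _ _ => 0) (fun _ => locLip_zero) (fun _ => memLp_zero hΩ hp1) ?_ ?_
  · unfold LpTendsto
    have : ∀ i : ℕ, luxNorm p Ω (fun x => 0 - u x) = 0 := fun i =>
      lux_zero_of hΩ hp1 (hu.mono fun x hx => by simp [hx])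
    simp only [this 0]
    exact tendsto_const_nhds
  · intro i
    exact (int_zero (f := fun x => ‖fderiv ℝ (fun _ : Eu n => (0 : ℝ)) x‖) hΩ hp1
      (Eventually.of_forall fun x => by simp)).le

theorem bv_le_one (hΩ : IsOpen Ω) (hpm : Measurable p) (hp1 : ∀ x ∈ Ω, 1 ≤ p x)
    {u : Eu n → ℝ} (hu : MemBVt p Ω u) :
    ∃ l : ℝ, 0 < l ∧ bvModular p Ω (fun x => u x / l) ≤ 1 := by
  obtain ⟨C, hC, hCt⟩ := exists_between hu.2
  obtain ⟨k, hk, hk1⟩ := exists_scale hCt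
  refine ⟨k, by linarith, ?_⟩
  refine le_trans (le_of_eq ?_) ((bvMod_smul hΩ hpm hp1 hC (abs_inv_le hk)).trans hk1)
  congr 1
  funext x
  rw [inv_mul_eq_div]

theorem bvMod_add_le (hΩ : IsOpen Ω) (hpm : Measurable p) (hp1 : ∀ x ∈ Ω, 1 ≤ p x)
    {u v : Eu n → ℝ} (hu : MemLpVar p Ω u) (hv : MemLpVar p Ω v) (a b : ℝ) (ha : 0 < a)
    (hb : 0 < b)
    (h1 : bvModular p Ω (fun x => u x / a) ≤ 1) (h2 : bvModular p Ω (fun x => v x / b) ≤ 1) :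
    bvModular p Ω (fun x => (u x + v x) / (a + b)) ≤ 1 := by
  refine le_of_forall_gt_imp_ge_of_dense fun C hC => ?_
  obtain ⟨f, f1, f2, f3, f4⟩ := bvMod_seq (h1.trans_lt hC)
  obtain ⟨g, g1, g2, g3, g4⟩ := bvMod_seq (h2.trans_lt hC)
  have hs : a / (a + b) + b / (a + b) = 1 := by rw [← add_div]; exact div_self (by positivity)
  have e : (fun x => (u x + v x) / (a + b)) =
      fun x => a / (a + b) * (u x / a) + b / (a + b) * (v x / b) := by
    funext x
    have : a + b ≠ 0 := by positivity
    field_simp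
  have hua : MemLpVar p Ω (fun x => u x / a) := by
    convert memLp_mul hΩ hp1 hu a⁻¹ using 2
    rw [inv_mul_eq_div]
  have hvb : MemLpVar p Ω (fun x => v x / b) := by
    convert memLp_mul hΩ hp1 hv b⁻¹ using 2
    rw [inv_mul_eq_div]
  rw [e]
  refine bvMod_le (fun i x => a / (a + b) * f i x + b / (a + b) * g i x)
    (fun i => locLip_comb (f1 i) (g1 i) _ _)
    (fun i => memLp_add hΩ hpm hp1 (memLp_mul hΩ hp1 (f2 i) _) (memLp_mul hΩ hp1 (g2 i) _))
    (lpTendsto_add hΩ hpm hp1 (fun i => memLp_mul hΩ hp1 (f2 i) _)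
      (fun i => memLp_mul hΩ hp1 (g2 i) _) (memLp_mul hΩ hp1 hua _) (memLp_mul hΩ hp1 hvb _)
      (lpTendsto_mul hΩ hp1 f3 _) (lpTendsto_mul hΩ hp1 g3 _)) (fun i => ?_)
  refine (gMod_comb hΩ hpm hp1 (f1 i) (g1 i) (by positivity) (by positivity) hs).trans ?_
  refine (add_le_add (mul_le_mul_right (f4 i) _) (mul_le_mul_right (g4 i) _)).trans ?_
  rw [← add_mul, ← ENNReal.ofReal_add (by positivity) (by positivity), hs,
    ENNReal.ofReal_one, one_mul]

theorem ae_zero_of_lux (hΩ : IsOpen Ω) (hpm : Measurable p) (hp1 : ∀ x ∈ Ω, 1 ≤ p x)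
    {u : Eu n → ℝ} (hu : MemLpVar p Ω u) (h0 : luxNorm p Ω u = 0) :
    ∀ᵐ x ∂(volume.restrict Ω), u x = 0 := by
  have hle : ∀ ε : ℝ, 0 < ε → ε ≤ 1 → vModular p Ω u ≤ ENNReal.ofReal ε := by
    intro ε hε hε1
    obtain ⟨l, ⟨hl, hl1⟩, hlε⟩ := Real.lt_sInf_add_pos
      (s := {l : ℝ | 0 < l ∧ vModular p Ω (fun x => u x / l) ≤ 1})
      (memLp_le_one hΩ hpm hp1 hu) hε
    change l < luxNorm p Ω u + ε at hlε
    rw [h0, zero_add] at hlε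
    have := vMod_smul hΩ hpm hp1 (hu.1.div_const l) (c := l)
      (by rw [abs_of_pos hl]; linarith)
    have e : (fun x => l * (u x / l)) = u := by
      funext x
      field_simp
    rw [e, abs_of_pos hl] at this
    refine this.trans ((mul_le_mul_right hl1 _).trans ?_)
    rw [mul_one]
    exact ENNReal.ofReal_le_ofReal hlε.le
  have hz : vModular p Ω u = 0 := by
    by_contra hne
    have hpos : 0 < vModular p Ω u := pos_iff_ne_zero.2 hne
    have hfin : vModular p Ω u < ⊤ := (hle 1 one_pos le_rfl).trans_lt ENNReal.ofReal_lt_top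
    have hr : 0 < (vModular p Ω u).toReal := ENNReal.toReal_pos hne hfin.ne
    have h := hle (min 1 ((vModular p Ω u).toReal / 2)) (by positivity) (min_le_left _ _)
    have h' := ENNReal.toReal_mono ENNReal.ofReal_ne_top h
    rw [ENNReal.toReal_ofReal (by positivity)] at h'
    have := min_le_right 1 ((vModular p Ω u).toReal / 2)
    linarith
  unfold vModular at hz
  have hmu : Measurable (fun x => ENNReal.ofReal (|u x| ^ p x)) :=
    ((continuous_abs.measurable.comp hu.1).pow hpm).ennreal_ofReal
  rw [lintegral_eq_zero_iff hmu] at hz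
  filter_upwards [hz, ae_restrict_mem hΩ.measurableSet] with x hx hxΩ
  have hq := hp1 x hxΩ
  have hx' : |u x| ^ p x ≤ 0 := ENNReal.ofReal_eq_zero.1 hx
  have := (Real.rpow_eq_zero (abs_nonneg (u x)) (by linarith : p x ≠ 0)).1
    (le_antisymm hx' (Real.rpow_nonneg (abs_nonneg _) _))
  exact abs_eq_zero.1 this

end BVHelpers

/-- `B̃V^{p(·)}(Ω)` is a normed space: the quantity `‖·‖_{B̃V}`
satisfies the triangle inequality, is positively homogeneous, and vanishes
exactly when `u = 0` in `L^{p(·)}(Ω)` (i.e. a.e. on `Ω`). -/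
theorem bvNorm_is_norm
    {n : ℕ} (p : Eu n → ℝ) (Ω : Set (Eu n)) (hΩ : IsOpen Ω)
    (hpm : Measurable p) (hp1 : ∀ x ∈ Ω, 1 ≤ p x) (hpb : ∃ M : ℝ, ∀ x ∈ Ω, p x ≤ M) :
    (∀ u v : Eu n → ℝ, MemBVt p Ω u → MemBVt p Ω v →
      bvNorm p Ω (fun x => u x + v x) ≤ bvNorm p Ω u + bvNorm p Ω v) ∧
    (∀ (u : Eu n → ℝ) (c : ℝ), MemBVt p Ω u →
      bvNorm p Ω (fun x => c * u x) = |c| * bvNorm p Ω u) ∧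
    (∀ u : Eu n → ℝ, MemBVt p Ω u →
      (bvNorm p Ω u = 0 ↔ ∀ᵐ x ∂(volume.restrict Ω), u x = 0)) := by
  refine ⟨fun u v hu hv => ?_, fun u c hu => ?_, fun u hu => ⟨fun h => ?_, fun h => ?_⟩⟩
  · have h1 := lux_add hΩ hpm hp1 hu.1 hv.1
    have h2 := lnorm_add (ρ := bvModular p Ω) (bv_le_one hΩ hpm hp1 hu)
      (bv_le_one hΩ hpm hp1 hv) (bvMod_add_le hΩ hpm hp1 hu.1 hv.1)
    change luxNorm p Ω _ + lnorm (bvModular p Ω) _ ≤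
      (luxNorm p Ω _ + lnorm (bvModular p Ω) _) + (luxNorm p Ω _ + lnorm (bvModular p Ω) _)
    linarith
  · have h2 := lnorm_mul (ρ := bvModular p Ω)
      (by rw [bvMod_zero_of hΩ hp1 (Eventually.of_forall fun x => rfl)]; exact zero_le_one)
      (bvMod_neg hΩ hpm hp1) u c
    change luxNorm p Ω _ + lnorm (bvModular p Ω) _ =
      |c| * (luxNorm p Ω _ + lnorm (bvModular p Ω) _)
    rw [h2, lux_mul hΩ hp1, mul_add]
  · change luxNorm p Ω _ + lnorm (bvModular p Ω) _ = 0 at h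
    have h1 := lnorm_nonneg (bvModular p Ω) u
    have h2 : 0 ≤ luxNorm p Ω u := lnorm_nonneg (vModular p Ω) u
    exact ae_zero_of_lux hΩ hpm hp1 hu.1 (by linarith)
  · change luxNorm p Ω _ + lnorm (bvModular p Ω) _ = 0
    rw [lux_zero_of hΩ hp1 h, zero_add]
    exact lnorm_zero_of fun l _ => by
      rw [bvMod_zero_of hΩ hp1 (h.mono fun x hx => by simp [hx])]
      exact zero_le_one
end
end

section
/- (Lattice property of the mixed pseudo-modular.) Let u, v ∈ B̃V^{p(·)}(Ω). Then ρ̃_{BV^{p(·)}(Ω)}(max{u,v}) + ρ̃_{BV^{p(·)}(Ω)}(min{u,v}) ≤ ρ̃_{BV^{p(·)}(Ω)}(u) + ρ̃_{BV^{p(·)}(Ω)}(v). -/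
open MeasureTheory Filter Topology ENNReal Set

noncomputable section

namespace BVLat

variable {n : ℕ} {p : Eu n → ℝ} {Ω : Set (Eu n)}

lemma vMod_le_add (hΩ : IsOpen Ω) (hpm : Measurable p) (hp1 : ∀ x ∈ Ω, 1 ≤ p x)
    {f g h : Eu n → ℝ} (hf : Measurable f)
    (hle : ∀ x ∈ Ω, |h x| ≤ max |f x| |g x|) :
    vModular p Ω h ≤ vModular p Ω f + vModular p Ω g := by
  unfold vModular
  rw [← lintegral_add_left]
  · refine setLIntegral_mono' hΩ.measurableSet fun x hx => ?_
    have hp : 0 ≤ p x := by linarith [hp1 x hx]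
    rcases le_total |f x| |g x| with hh | hh
    · refine le_trans (ENNReal.ofReal_le_ofReal ?_) le_add_self
      exact Real.rpow_le_rpow (abs_nonneg _) ((hle x hx).trans (by simp [hh])) hp
    · refine le_trans (ENNReal.ofReal_le_ofReal ?_) le_self_add
      exact Real.rpow_le_rpow (abs_nonneg _) ((hle x hx).trans (by simp [hh])) hp
  · exact (Measurable.pow (by fun_prop) hpm).ennreal_ofReal

lemma vMod_scale (hΩ : IsOpen Ω) (hp1 : ∀ x ∈ Ω, 1 ≤ p x)
    (f : Eu n → ℝ) {l m : ℝ} (hl : 0 < l) (hlm : l ≤ m) :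
    vModular p Ω (fun x => f x / m) ≤
      ENNReal.ofReal (l / m) * vModular p Ω (fun x => f x / l) := by
  have hm : 0 < m := hl.trans_le hlm
  unfold vModular
  rw [← lintegral_const_mul' _ _ ENNReal.ofReal_ne_top]
  refine setLIntegral_mono' hΩ.measurableSet fun x hx => ?_
  rw [← ENNReal.ofReal_mul (by positivity)]
  apply ENNReal.ofReal_le_ofReal
  have h1 : |f x / m| = (l / m) * |f x / l| := by
    rw [abs_div, abs_div, abs_of_pos hl, abs_of_pos hm]; field_simp
  rw [h1, Real.mul_rpow (by positivity) (by positivity)]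
  gcongr
  have := Real.rpow_le_rpow_of_exponent_ge (x := l / m) (by positivity)
    ((div_le_one hm).2 hlm) (hp1 x hx)
  simpa using this

lemma exists_le_one (hΩ : IsOpen Ω) (hp1 : ∀ x ∈ Ω, 1 ≤ p x)
    {f : Eu n → ℝ} {l : ℝ} (hl : 0 < l) (hfin : vModular p Ω (fun x => f x / l) < ⊤) :
    {l : ℝ | 0 < l ∧ vModular p Ω (fun x => f x / l) ≤ 1}.Nonempty := by
  set R := (vModular p Ω (fun x => f x / l)).toReal with hR
  have hR0 : 0 ≤ R := ENNReal.toReal_nonneg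
  refine ⟨l * (1 + R), by positivity, ?_⟩
  refine (vMod_scale hΩ hp1 f hl (by nlinarith)).trans ?_
  rw [← ENNReal.ofReal_toReal hfin.ne, ← hR, ← ENNReal.ofReal_mul (by positivity)]
  rw [← ENNReal.ofReal_one]
  apply ENNReal.ofReal_le_ofReal
  have : l / (l * (1 + R)) * R = R / (1 + R) := by field_simp
  rw [this, div_le_one (by positivity)]
  linarith

lemma le_one_of_lux_lt (hΩ : IsOpen Ω) (hp1 : ∀ x ∈ Ω, 1 ≤ p x)
    {f : Eu n → ℝ} {l : ℝ} 
    (hne : {l : ℝ | 0 < l ∧ vModular p Ω (fun x => f x / l) ≤ 1}.Nonempty)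
    (hl : luxNorm p Ω f < l) : vModular p Ω (fun x => f x / l) ≤ 1 := by
  obtain ⟨m, ⟨hm0, hm⟩, hml⟩ := exists_lt_of_csInf_lt hne hl
  refine (vMod_scale hΩ hp1 f hm0 hml.le).trans ?_
  refine mul_le_one' ?_ hm
  rw [← ENNReal.ofReal_one]
  apply ENNReal.ofReal_le_ofReal
  rw [div_le_one (hm0.trans hml)]
  exact hml.le

lemma lux_nonneg (f : Eu n → ℝ) : 0 ≤ luxNorm p Ω f :=
  Real.sInf_nonneg fun _ h => h.1.le

lemma lux_le (hΩ : IsOpen Ω) (hpm : Measurable p) (hp1 : ∀ x ∈ Ω, 1 ≤ p x)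
    {f g h : Eu n → ℝ} (hf : Measurable f)
    (hle : ∀ x ∈ Ω, |h x| ≤ max |f x| |g x|) {l : ℝ} (hl : 0 < l)
    (hfl : vModular p Ω (fun x => f x / l) ≤ 1)
    (hgl : vModular p Ω (fun x => g x / l) ≤ 1) : luxNorm p Ω h ≤ 2 * l := by
  refine csInf_le ⟨0, fun _ h => h.1.le⟩ ⟨by positivity, ?_⟩
  have h2 : l / (2 * l) = 1 / 2 := by field_simp
  have half : ENNReal.ofReal (1 / 2) + ENNReal.ofReal (1 / 2) = 1 := by
    rw [← ENNReal.ofReal_add (by norm_num) (by norm_num)]; norm_num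
  have key : ∀ k : Eu n → ℝ, vModular p Ω (fun x => k x / l) ≤ 1 →
      vModular p Ω (fun x => k x / (2 * l)) ≤ ENNReal.ofReal (1 / 2) := fun k hk => by
    refine (vMod_scale hΩ hp1 k hl (by linarith)).trans ?_
    rw [h2]
    exact mul_le_of_le_one_right' hk
  refine (vMod_le_add hΩ hpm hp1 (f := fun x => f x / (2 * l)) (g := fun x => g x / (2 * l))
    (by fun_prop) fun x hx => ?_).trans ((add_le_add (key f hfl) (key g hgl)).trans half.le)
  simp only [abs_div]
  rw [max_div_div_right (abs_nonneg _)]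
  gcongr
  exact hle x hx

lemma mem_of_le (hΩ : IsOpen Ω) (hpm : Measurable p) (hp1 : ∀ x ∈ Ω, 1 ≤ p x)
    {f g h : Eu n → ℝ} (hf : MemLpVar p Ω f) (hg : MemLpVar p Ω g) (hh : Measurable h)
    (hle : ∀ x ∈ Ω, |h x| ≤ 2 * max |f x| |g x|) : MemLpVar p Ω h := by
  obtain ⟨hfm, l, hl, hfl⟩ := hf
  obtain ⟨hgm, m, hm, hgm'⟩ := hg
  have key : ∀ (k : Eu n → ℝ) (a : ℝ), 0 < a → a ≤ max l m →
      vModular p Ω (fun x => k x / a) < ⊤ → vModular p Ω (fun x => k x / max l m) < ⊤ := by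
    intro k a ha hle hk
    exact (vMod_scale hΩ hp1 k ha hle).trans_lt (ENNReal.mul_lt_top ENNReal.ofReal_lt_top hk)
  have hM : 0 < max l m := lt_max_of_lt_left hl
  refine ⟨hh, 2 * max l m, by positivity, ?_⟩
  refine (vMod_le_add hΩ hpm hp1 (f := fun x => f x / max l m) (g := fun x => g x / max l m)
    (by fun_prop) fun x hx => ?_).trans_lt
      (ENNReal.add_lt_top.2 ⟨key f l hl (le_max_left _ _) hfl, key g m hm (le_max_right _ _) hgm'⟩)
  simp only [abs_div]
  rw [max_div_div_right (abs_nonneg _), abs_of_pos hM, abs_of_pos (by positivity : 0 < 2 * max l m),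
    div_le_div_iff₀ (by positivity) hM]
  nlinarith [hle x hx]

lemma tendsto_of_le (hΩ : IsOpen Ω) (hpm : Measurable p) (hp1 : ∀ x ∈ Ω, 1 ≤ p x)
    {a b c : ℕ → Eu n → ℝ} {u v w : Eu n → ℝ}
    (ha : ∀ i, MemLpVar p Ω (a i)) (hb : ∀ i, MemLpVar p Ω (b i))
    (hu : MemLpVar p Ω u) (hv : MemLpVar p Ω v)
    (hau : LpTendsto p Ω a u) (hbv : LpTendsto p Ω b v)
    (hle : ∀ i x, |c i x - w x| ≤ max |a i x - u x| |b i x - v x|) :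
    LpTendsto p Ω c w := by
  have sub : ∀ {f g : Eu n → ℝ}, MemLpVar p Ω f → MemLpVar p Ω g →
      {l : ℝ | 0 < l ∧ vModular p Ω (fun x => (f x - g x) / l) ≤ 1}.Nonempty := by
    intro f g hf hg
    obtain ⟨-, l, hl, h⟩ := mem_of_le hΩ hpm hp1 hf hg (h := fun x => f x - g x)
      (hf.1.sub hg.1) (fun x _ => by
        have := abs_sub (f x) (g x)
        linarith [le_max_left |f x| |g x|, le_max_right |f x| |g x|])
    exact exists_le_one hΩ hp1 hl h
  unfold LpTendsto at *
  rw [Metric.tendsto_atTop] at *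
  intro ε hε
  obtain ⟨N, hN⟩ := hau (ε / 4) (by positivity)
  obtain ⟨M, hM⟩ := hbv (ε / 4) (by positivity)
  refine ⟨max N M, fun i hi => ?_⟩
  have h1 := hN i (le_trans (le_max_left _ _) hi)
  have h2 := hM i (le_trans (le_max_right _ _) hi)
  rw [Real.dist_eq, sub_zero, abs_of_nonneg (lux_nonneg _)] at *
  have := lux_le hΩ hpm hp1 (f := fun x => a i x - u x) (g := fun x => b i x - v x)
    (h := fun x => c i x - w x) ((ha i).1.sub hu.1) (fun x _ => hle i x)
    (l := ε / 4) (by positivity)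
    (le_one_of_lux_lt hΩ hp1 (sub (ha i) hu) h1) (le_one_of_lux_lt hΩ hp1 (sub (hb i) hv) h2)
  linarith

lemma locLip_of_le {f g h : Eu n → ℝ} (hf : LocLipOn Ω f) (hg : LocLipOn Ω g)
    (hle : ∀ x y, |h x - h y| ≤ max |f x - f y| |g x - g y|) : LocLipOn Ω h := by
  intro x hx
  obtain ⟨K, t, ht, hK⟩ := hf x hx
  obtain ⟨L, s, hs, hL⟩ := hg x hx
  refine ⟨max K L, t ∩ s, inter_mem ht hs, LipschitzOnWith.of_dist_le_mul fun y hy z hz => ?_⟩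
  have h1 := hK.dist_le_mul y hy.1 z hz.1
  have h2 := hL.dist_le_mul y hy.2 z hz.2
  rw [Real.dist_eq] at *
  refine (hle y z).trans (max_le (h1.trans ?_) (h2.trans ?_))
  · gcongr; exact le_max_left _ _
  · gcongr; exact le_max_right _ _

lemma ae_diff (hΩ : IsOpen Ω) {f : Eu n → ℝ} (hf : LocLipOn Ω f) :
    ∀ᵐ x ∂(volume.restrict Ω), DifferentiableAt ℝ f x := by
  rw [ae_restrict_iff' hΩ.measurableSet, ae_iff]
  refine measure_null_of_locally_null _ fun x hx => ?_
  have hxΩ : x ∈ Ω := by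
    by_contra h; exact hx fun h' => absurd h' h
  obtain ⟨K, t, ht, hK⟩ := hf x hxΩ
  rw [hΩ.nhdsWithin_eq hxΩ] at ht
  have h0 := hK.ae_differentiableWithinAt_of_mem (μ := volume)
  rw [ae_iff] at h0
  refine ⟨{x | ¬(x ∈ Ω → DifferentiableAt ℝ f x)} ∩ interior t,
    inter_mem self_mem_nhdsWithin (mem_nhdsWithin_of_mem_nhds (interior_mem_nhds.2 ht)), ?_⟩
  refine measure_mono_null (fun y hy => ?_) h0
  obtain ⟨hy1, hy2⟩ := hy
  simp only [mem_setOf_eq, Classical.not_imp] at hy1 ⊢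
  exact ⟨interior_subset hy2, fun hd => hy1.2 (hd.differentiableAt (mem_interior_iff_mem_nhds.1 hy2))⟩

lemma fderiv_eq_of_le {f g : Eu n → ℝ} {x : Eu n} (hf : DifferentiableAt ℝ f x)
    (hg : DifferentiableAt ℝ g x) (hle : ∀ y, f y ≤ g y) (he : f x = g x) :
    fderiv ℝ f x = fderiv ℝ g x := by
  have h : IsLocalMin (fun y => g y - f y) x := by
    refine Eventually.of_forall fun y => ?_
    simp only [he, sub_self]
    linarith [hle y]
  have := h.fderiv_eq_zero
  rw [fderiv_fun_sub hg hf, sub_eq_zero] at this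
  exact this.symm

lemma grad_le (hΩ : IsOpen Ω) (hpm : Measurable p) {f g : Eu n → ℝ}
    (hf : LocLipOn Ω f) (hg : LocLipOn Ω g) 
    (hM : LocLipOn Ω fun x => max (f x) (g x)) (hm : LocLipOn Ω fun x => min (f x) (g x)) :
    gradModular p Ω (fun x => max (f x) (g x)) + gradModular p Ω (fun x => min (f x) (g x))
      ≤ gradModular p Ω f + gradModular p Ω g := by
  have meas : ∀ k : Eu n → ℝ, Measurable fun x => ENNReal.ofReal (‖fderiv ℝ k x‖ ^ p x) :=
    fun k => (Measurable.pow (measurable_fderiv ℝ k).norm hpm).ennreal_ofReal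
  unfold gradModular
  rw [← lintegral_add_left (meas _), ← lintegral_add_left (meas _)]
  refine lintegral_mono_ae ?_
  filter_upwards [ae_diff hΩ hf, ae_diff hΩ hg, ae_diff hΩ hM, ae_diff hΩ hm] with x h1 h2 h3 h4
  rcases le_total (f x) (g x) with h | h
  · rw [← fderiv_eq_of_le h2 h3 (fun y => le_max_right _ _) (by simp [h]),
      fderiv_eq_of_le h4 h1 (fun y => min_le_left _ _) (by simp [h]), add_comm]
  · rw [← fderiv_eq_of_le h1 h3 (fun y => le_max_left _ _) (by simp [h]),
      fderiv_eq_of_le h4 h2 (fun y => min_le_right _ _) (by simp [h])]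

lemma liminf_add_le_of {a b : ℕ → ℝ≥0∞} {C : ℝ≥0∞} (h : ∀ i, a i + b i ≤ C) :
    liminf a atTop + liminf b atTop ≤ C := by
  rw [liminf_eq_iSup_iInf_of_nat, liminf_eq_iSup_iInf_of_nat,
    ENNReal.iSup_add_iSup_of_monotone]
  · refine iSup_le fun k => ?_
    exact (add_le_add (iInf₂_le k le_rfl) (iInf₂_le k le_rfl)).trans (h k)
  · exact fun i j hij => le_iInf₂ fun k hk => iInf₂_le k (hij.trans hk)
  · exact fun i j hij => le_iInf₂ fun k hk => iInf₂_le k (hij.trans hk)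

lemma exists_seq {u : Eu n → ℝ} {A : ℝ≥0∞} (h : bvModular p Ω u < A) :
    ∃ a : ℕ → Eu n → ℝ, (∀ i, LocLipOn Ω (a i)) ∧ (∀ i, MemLpVar p Ω (a i)) ∧
      LpTendsto p Ω a u ∧ ∀ i, gradModular p Ω (a i) ≤ A := by
  unfold bvModular at h
  simp only [iInf_lt_iff] at h
  obtain ⟨a, ⟨h1, h2⟩, h3⟩ := h
  obtain ⟨φ, hφ, hlt⟩ := extraction_of_frequently_atTop (frequently_lt_of_liminf_lt (by isBoundedDefault) h3)
  exact ⟨fun i => a (φ i), fun i => (h1 _).1, fun i => (h1 _).2,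
    h2.comp hφ.tendsto_atTop, fun i => (hlt i).le⟩

end BVLat

/-- lattice property of the mixed pseudo-modular. -/
theorem bvModular_lattice
    {n : ℕ} (p : Eu n → ℝ) (Ω : Set (Eu n)) (hΩ : IsOpen Ω)
    (hpm : Measurable p) (hp1 : ∀ x ∈ Ω, 1 ≤ p x) (hpb : ∃ M : ℝ, ∀ x ∈ Ω, p x ≤ M)
    (u v : Eu n → ℝ) (hu : MemBVt p Ω u) (hv : MemBVt p Ω v) :
    bvModular p Ω (fun x => max (u x) (v x)) +
      bvModular p Ω (fun x => min (u x) (v x)) ≤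
        bvModular p Ω u + bvModular p Ω v := by
  refine ENNReal.le_of_forall_pos_le_add fun ε hε _ => ?_
  have hε2 : ((ε : ℝ≥0∞) / 2) ≠ 0 := by simp [hε.ne']
  obtain ⟨a, a1, a2, a3, a4⟩ := BVLat.exists_seq (ENNReal.lt_add_right hu.2.ne hε2)
  obtain ⟨b, b1, b2, b3, b4⟩ := BVLat.exists_seq (ENNReal.lt_add_right hv.2.ne hε2)
  have hM : ∀ i, LocLipOn Ω fun x => max (a i x) (b i x) := fun i =>
    BVLat.locLip_of_le (a1 i) (b1 i) fun x y => abs_max_sub_max_le_max _ _ _ _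
  have hm : ∀ i, LocLipOn Ω fun x => min (a i x) (b i x) := fun i =>
    BVLat.locLip_of_le (a1 i) (b1 i) fun x y => abs_min_sub_min_le_max _ _ _ _
  have e1 : bvModular p Ω (fun x => max (u x) (v x)) ≤
      liminf (fun i => gradModular p Ω (fun x => max (a i x) (b i x))) atTop := by
    refine iInf₂_le (fun i x => max (a i x) (b i x)) ⟨fun i => ⟨hM i, ?_⟩, ?_⟩
    · refine BVLat.mem_of_le hΩ hpm hp1 (a2 i) (b2 i) ((a2 i).1.max (b2 i).1) fun x _ => ?_
      have := abs_max_sub_max_le_max (a i x) (b i x) 0 0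
      simp only [max_self, sub_zero] at this
      linarith [abs_nonneg (a i x), le_max_left |a i x| |b i x|]
    · exact BVLat.tendsto_of_le hΩ hpm hp1 a2 b2 hu.1 hv.1 a3 b3
        fun i x => abs_max_sub_max_le_max _ _ _ _
  have e2 : bvModular p Ω (fun x => min (u x) (v x)) ≤
      liminf (fun i => gradModular p Ω (fun x => min (a i x) (b i x))) atTop := by
    refine iInf₂_le (fun i x => min (a i x) (b i x)) ⟨fun i => ⟨hm i, ?_⟩, ?_⟩
    · refine BVLat.mem_of_le hΩ hpm hp1 (a2 i) (b2 i) ((a2 i).1.min (b2 i).1) fun x _ => ?_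
      have := abs_min_sub_min_le_max (a i x) (b i x) 0 0
      simp only [min_self, sub_zero] at this
      linarith [abs_nonneg (a i x), le_max_left |a i x| |b i x|]
    · exact BVLat.tendsto_of_le hΩ hpm hp1 a2 b2 hu.1 hv.1 a3 b3
        fun i x => abs_min_sub_min_le_max _ _ _ _
  refine (add_le_add e1 e2).trans (BVLat.liminf_add_le_of fun i => ?_)
  refine (BVLat.grad_le hΩ hpm (a1 i) (b1 i) (hM i) (hm i)).trans
    ((add_le_add (a4 i) (b4 i)).trans_eq ?_)
  rw [add_add_add_comm, ENNReal.add_halves]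
end
end

section
/- Let Ω ⊂ ℝⁿ be a bounded open set and let p be a locally log-Hölder continuous variable exponent on Ω with p⁺ < ∞, and let u ∈ BV^{p(·)}(Ω). Then for every closed set F ⊂ Ω and the standard mollifications u_δ = φ_δ ∗ u, there is a constant C with 1 ≤ C < ∞, depending only on the log-Hölder constant of p, such that limsup_{δ→0} ρ_{BV^{p(·)}(F)}(u_δ) ≤ C · ρ_{BV^{p(·)}(F)}(u). -/
open MeasureTheory Filter Topology ENNReal Set

noncomputable section

section Helpers
open scoped Pointwise Manifold

structure IsKer {n : ℕ} (κ : Eu n → ℝ) (δ : ℝ) : Prop where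
  smooth : ContDiff ℝ (⊤ : ℕ∞) κ
  nonneg : ∀ x, 0 ≤ κ x
  supp : ∀ x, δ < ‖x‖ → κ x = 0
  int : ∫ x, κ x = 1

def scaleKer {n : ℕ} (φ : Eu n → ℝ) (δ : ℝ) (z : Eu n) : ℝ := (δ ^ n)⁻¹ * φ (δ⁻¹ • z)

def Mo {n : ℕ} (κ h : Eu n → ℝ) (x : Eu n) : ℝ := ∫ y, κ (x - y) * h y

lemma mollify_eq_Mo {n : ℕ} {Ω : Set (Eu n)} (hΩ : MeasurableSet Ω) (u φ : Eu n → ℝ) (δ : ℝ) :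
    mollify Ω u φ δ = Mo (scaleKer φ δ) (Ω.indicator u) := by
  ext x
  unfold mollify Mo scaleKer
  rw [← integral_indicator hΩ]
  congr 1
  ext y
  by_cases h : y ∈ Ω <;> simp [h]

lemma IsKer.hcs {n : ℕ} {κ : Eu n → ℝ} {δ : ℝ} (h : IsKer κ δ) : HasCompactSupport κ := by
  apply HasCompactSupport.intro (isCompact_closedBall (0 : Eu n) δ)
  intro x hx
  apply h.supp
  simpa using hx

lemma IsKer.integrable {n : ℕ} {κ : Eu n → ℝ} {δ : ℝ} (h : IsKer κ δ) : Integrable κ :=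
  h.smooth.continuous.integrable_of_hasCompactSupport h.hcs

lemma scaleKer_isKer {n : ℕ} {φ : Eu n → ℝ} (h : IsKer φ 1) {δ : ℝ} (hδ : 0 < δ) :
    IsKer (scaleKer φ δ) δ where
  smooth := by
    unfold scaleKer
    have := h.smooth
    fun_prop
  nonneg x := mul_nonneg (by positivity) (h.nonneg _)
  supp x hx := by
    unfold scaleKer
    rw [h.supp, mul_zero]
    rw [norm_smul, norm_inv, Real.norm_of_nonneg hδ.le, ← div_eq_inv_mul, lt_div_iff₀ hδ]
    simpa using hx
  int := by
    unfold scaleKer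
    rw [integral_const_mul, Measure.integral_comp_inv_smul_of_nonneg _ _ hδ.le, h.int]
    simp
    field_simp

lemma bounded_of_hcs {n : ℕ} {F : Type*} [NormedAddCommGroup F] {f : Eu n → F} (hf : Continuous f)
    (hc : HasCompactSupport f) : ∃ B : ℝ, 1 ≤ B ∧ ∀ x, ‖f x‖ ≤ B := by
  obtain ⟨C, hC⟩ := hf.bounded_above_of_compact_support hc
  exact ⟨max 1 C, le_max_left _ _, fun x => (hC x).trans (le_max_right _ _)⟩

lemma scaleKer_le {n : ℕ} {φ : Eu n → ℝ} (h : IsKer φ 1) :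
    ∃ B : ℝ, 1 ≤ B ∧ ∀ δ > 0, ∀ z, scaleKer φ δ z ≤ B * (δ ^ n)⁻¹ := by
  obtain ⟨B, hB, hb⟩ := bounded_of_hcs h.smooth.continuous h.hcs
  refine ⟨B, hB, fun δ hδ z => ?_⟩
  unfold scaleKer
  rw [mul_comm]
  gcongr
  exact (le_abs_self _).trans (hb _)

lemma scaleKer_fderiv {n : ℕ} {φ : Eu n → ℝ} (h : IsKer φ 1) (δ : ℝ) (z : Eu n) :
    fderiv ℝ (scaleKer φ δ) z = (δ ^ n)⁻¹ • (δ⁻¹ • fderiv ℝ φ (δ⁻¹ • z)) := by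
  have h1 : HasFDerivAt φ (fderiv ℝ φ (δ⁻¹ • z)) (δ⁻¹ • z) :=
    (h.smooth.differentiable (by simp)).differentiableAt.hasFDerivAt
  have h2 : HasFDerivAt (fun z : Eu n => δ⁻¹ • z) (δ⁻¹ • ContinuousLinearMap.id ℝ (Eu n)) z :=
    (hasFDerivAt_id z).const_smul δ⁻¹
  have h3 := (h1.comp z h2).const_mul ((δ ^ n)⁻¹)
  have := h3.fderiv
  unfold scaleKer
  simp only [Function.comp_def] at this
  rw [this]
  ext v
  simp

lemma scaleKer_fderiv_bound {n : ℕ} {φ : Eu n → ℝ} (h : IsKer φ 1) :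
    ∃ B : ℝ, 1 ≤ B ∧ (∀ δ > 0, ∀ z, ‖fderiv ℝ (scaleKer φ δ) z‖ ≤ B * (δ ^ (n + 1))⁻¹) ∧
      ∀ δ > 0, ∫ z, ‖fderiv ℝ (scaleKer φ δ) z‖ ≤ B * δ⁻¹ := by
  have hc1 : Continuous (fderiv ℝ φ) := h.smooth.continuous_fderiv (by simp)
  obtain ⟨B, hB, hb⟩ := bounded_of_hcs hc1 (h.hcs.fderiv ℝ)
  refine ⟨max B (∫ z, ‖fderiv ℝ φ z‖), le_max_of_le_left hB, fun δ hδ z => ?_, fun δ hδ => ?_⟩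
  · rw [scaleKer_fderiv h, norm_smul, norm_smul, norm_inv, norm_inv, norm_pow,
      Real.norm_of_nonneg hδ.le, pow_succ, mul_inv, ← mul_assoc, mul_comm]
    gcongr
    exact (hb _).trans (le_max_left _ _)
  · have : ∀ z, ‖fderiv ℝ (scaleKer φ δ) z‖ = (δ ^ n)⁻¹ * (δ⁻¹ * ‖fderiv ℝ φ (δ⁻¹ • z)‖) := by
      intro z
      rw [scaleKer_fderiv h, norm_smul, norm_smul, norm_inv, norm_inv, norm_pow,
        Real.norm_of_nonneg hδ.le]
    simp_rw [this]
    rw [integral_const_mul, integral_const_mul,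
      Measure.integral_comp_inv_smul_of_nonneg volume (fun z => ‖fderiv ℝ φ z‖) hδ.le]
    simp only [finrank_euclideanSpace, Fintype.card_fin, smul_eq_mul]
    rw [show (δ ^ n)⁻¹ * (δ⁻¹ * (δ ^ n * ∫ z, ‖fderiv ℝ φ z‖)) =  (∫ z, ‖fderiv ℝ φ z‖) * δ⁻¹ by
      field_simp]
    gcongr
    exact le_max_right _ _

lemma Mo_eq_conv {n : ℕ} (κ h : Eu n → ℝ) :
    Mo κ h = MeasureTheory.convolution h κ (ContinuousLinearMap.mul ℝ ℝ) volume := by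
  ext x
  simp [Mo, MeasureTheory.convolution, mul_comm]

lemma Mo_contDiff {n : ℕ} {κ h : Eu n → ℝ} {δ : ℝ} (hκ : IsKer κ δ) (hh : Integrable h) :
    ContDiff ℝ (⊤ : ℕ∞) (Mo κ h) := by
  rw [Mo_eq_conv]
  exact hκ.hcs.contDiff_convolution_right _ hh.locallyIntegrable hκ.smooth

lemma Mo_hasFDerivAt {n : ℕ} {κ h : Eu n → ℝ} {δ : ℝ} (hκ : IsKer κ δ) (hh : Integrable h)
    (x : Eu n) :
    HasFDerivAt (Mo κ h) (∫ y, h y • fderiv ℝ κ (x - y)) x := by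
  rw [Mo_eq_conv]
  have := hκ.hcs.hasFDerivAt_convolution_right (ContinuousLinearMap.mul ℝ ℝ)
    hh.locallyIntegrable (hκ.smooth.of_le (by simp)) x
  have e : (∫ y, h y • fderiv ℝ κ (x - y)) = MeasureTheory.convolution h (fderiv ℝ κ)
      (ContinuousLinearMap.precompR (Eu n) (ContinuousLinearMap.mul ℝ ℝ)) volume x := by
    unfold MeasureTheory.convolution
    congr 1
  rw [e]
  exact this

lemma Mo_integrand_integrable {n : ℕ} {κ h : Eu n → ℝ} {δ : ℝ} (hκ : IsKer κ δ)
    (hh : Integrable h) (x : Eu n) : Integrable (fun y => κ (x - y) * h y) := by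
  obtain ⟨B, hB, hb⟩ := bounded_of_hcs hκ.smooth.continuous hκ.hcs
  refine hh.bdd_mul (c := B) ?_ ?_
  · exact (hκ.smooth.continuous.comp (by fun_prop)).aestronglyMeasurable
  · exact Eventually.of_forall fun y => hb _

lemma norm_fderiv_Mo_le {n : ℕ} {κ h : Eu n → ℝ} {δ : ℝ} (hκ : IsKer κ δ) (hh : Integrable h)
    (x : Eu n) : ‖fderiv ℝ (Mo κ h) x‖ ≤ ∫ y, |h y| * ‖fderiv ℝ κ (x - y)‖ := by
  rw [(Mo_hasFDerivAt hκ hh x).fderiv]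
  refine (norm_integral_le_integral_norm _).trans (le_of_eq ?_)
  simp [norm_smul]

lemma norm_fderiv_Mo_le_sup {n : ℕ} {κ h : Eu n → ℝ} {δ : ℝ} (hκ : IsKer κ δ)
    (hh : Integrable h) {B : ℝ} (hB : ∀ z, ‖fderiv ℝ κ z‖ ≤ B)
    (x : Eu n) : ‖fderiv ℝ (Mo κ h) x‖ ≤ (∫ y, |h y|) * B := by
  refine (norm_fderiv_Mo_le hκ hh x).trans ?_
  rw [← integral_mul_const]
  refine integral_mono_of_nonneg (Eventually.of_forall fun y => by positivity)
    (hh.abs.mul_const B) (Eventually.of_forall fun y => ?_)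
  exact mul_le_mul_of_nonneg_left (hB _) (abs_nonneg _)

lemma norm_fderiv_Mo_le_bdd {n : ℕ} {κ h : Eu n → ℝ} {δ : ℝ} (hκ : IsKer κ δ)
    (hh : Integrable h) {A : ℝ} (hA : ∀ z, |h z| ≤ A)
    (x : Eu n) : ‖fderiv ℝ (Mo κ h) x‖ ≤ A * ∫ z, ‖fderiv ℝ κ z‖ := by
  refine (norm_fderiv_Mo_le hκ hh x).trans ?_
  rw [← integral_sub_left_eq_self (fun z => ‖fderiv ℝ κ z‖) volume x, ← integral_const_mul]
  have hi : Integrable (fderiv ℝ κ) := 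
    (hκ.smooth.continuous_fderiv (by simp)).integrable_of_hasCompactSupport (hκ.hcs.fderiv ℝ)
  refine integral_mono_of_nonneg (Eventually.of_forall fun y => by positivity)
    ((hi.norm.comp_sub_left x).const_mul A) (Eventually.of_forall fun y => ?_)
  exact mul_le_mul_of_nonneg_right (hA _) (norm_nonneg _)


structure IsTest {n : ℕ} (U : Set (Eu n)) (Θ : Eu n → Eu n) : Prop where
  cd : ContDiff ℝ 1 Θ
  hcs : HasCompactSupport Θ
  sub : tsupport Θ ⊆ U
  le : ∀ x, ‖Θ x‖ ≤ 1

lemma divg_eq_zero {n : ℕ} {Θ : Eu n → Eu n} {x : Eu n} (hx : x ∉ tsupport Θ) :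
    divg Θ x = 0 := by
  have : fderiv ℝ Θ x = 0 := by
    by_contra h
    exact hx (support_fderiv_subset ℝ h)
  simp [divg, this]

lemma divg_continuous {n : ℕ} {Θ : Eu n → Eu n} (h : ContDiff ℝ 1 Θ) : Continuous (divg Θ) := by
  unfold divg
  have := h.continuous_fderiv (by simp)
  fun_prop

lemma divg_hcs {n : ℕ} {Θ : Eu n → Eu n} (h : HasCompactSupport Θ) :
    HasCompactSupport (divg Θ) :=
  HasCompactSupport.intro h fun _ hx => divg_eq_zero hx

lemma le_tv {n : ℕ} {U : Set (Eu n)} {Θ : Eu n → Eu n} (h : IsTest U Θ) (u : Eu n → ℝ) :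
    ENNReal.ofReal (∫ x, u x * divg Θ x) ≤ totVarOpen U u := by
  have : ∫ x, u x * divg Θ x = ∫ x in U, u x * divg Θ x := by
    rw [setIntegral_eq_integral_of_forall_compl_eq_zero]
    intro x hx
    rw [divg_eq_zero (fun h' => hx (h.sub h')), mul_zero]
  rw [this]
  unfold totVarOpen
  exact le_iSup₂_of_le Θ ⟨h.cd, h.hcs, h.sub, h.le⟩ le_rfl

lemma tv_le {n : ℕ} {U : Set (Eu n)} {u : Eu n → ℝ} {A : ℝ≥0∞}
    (h : ∀ Θ, IsTest U Θ → ENNReal.ofReal (∫ x, u x * divg Θ x) ≤ A) : totVarOpen U u ≤ A := by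
  unfold totVarOpen
  refine iSup₂_le fun Θ hΘ => ?_
  have hT : IsTest U Θ := ⟨hΘ.1, hΘ.2.1, hΘ.2.2.1, hΘ.2.2.2⟩
  have : ∫ x, u x * divg Θ x = ∫ x in U, u x * divg Θ x := by
    rw [setIntegral_eq_integral_of_forall_compl_eq_zero]
    intro x hx
    rw [divg_eq_zero (fun h' => hx (hT.sub h')), mul_zero]
  rw [← this]
  exact h Θ hT

lemma tv_congr {n : ℕ} {U : Set (Eu n)} {u v : Eu n → ℝ} (hU : MeasurableSet U)
    (h : ∀ x ∈ U, u x = v x) :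
    totVarOpen U u = totVarOpen U v := by
  unfold totVarOpen
  congr 1; ext Θ; congr 1; ext hΘ; congr 1
  exact setIntegral_congr_fun hU fun x hx => by simp [h x hx]

lemma divg_eq {n : ℕ} {Θ : Eu n → Eu n} (h : ContDiff ℝ 1 Θ) (x : Eu n) :
    divg Θ x = ∑ i, fderiv ℝ (fun y => Θ y i) x (EuclideanSpace.single i 1) := by
  unfold divg
  refine Finset.sum_congr rfl fun i _ => ?_
  have h1 : HasFDerivAt Θ (fderiv ℝ Θ x) x :=
    (h.differentiable (by simp)).differentiableAt.hasFDerivAt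
  have h2 := ((EuclideanSpace.proj i : Eu n →L[ℝ] ℝ).hasFDerivAt.comp x h1).fderiv
  have h3 : (fun y => Θ y i) = (EuclideanSpace.proj i : Eu n →L[ℝ] ℝ) ∘ Θ := by
    ext y; simp
  rw [h3, h2]
  simp

lemma clm_eq_sum {n : ℕ} (A : Eu n →L[ℝ] ℝ) (y : Eu n) :
    A y = ∑ i, A (EuclideanSpace.single i 1) * y i := by
  conv_lhs => rw [← (EuclideanSpace.basisFun (Fin n) ℝ).sum_repr y]
  simp [mul_comm]

lemma ibp {n : ℕ} {v : Eu n → ℝ} {Θ : Eu n → Eu n} (hv : ContDiff ℝ 1 v) (hΘ : ContDiff ℝ 1 Θ)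
    (hc : HasCompactSupport Θ) :
    ∫ x, v x * divg Θ x = - ∫ x, fderiv ℝ v x (Θ x) := by
  have hvf := hv.continuous_fderiv (by simp)
  have hvc := hv.continuous
  have hcd : ∀ i, ContDiff ℝ 1 (fun y => Θ y i) := fun i => by fun_prop
  have hci : ∀ i, HasCompactSupport (fun y => Θ y i) := fun i =>
    hc.comp_left (g := fun y : Eu n => y i) (by simp)
  have hfc : ∀ i, Continuous (fderiv ℝ (fun y => Θ y i)) := fun i =>
    (hcd i).continuous_fderiv (by simp)
  have i1 : ∀ i, Integrable (fun x => v x *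
      fderiv ℝ (fun y => Θ y i) x (EuclideanSpace.single i 1)) := fun i => by
    apply Continuous.integrable_of_hasCompactSupport
    · have := hfc i
      fun_prop
    · exact HasCompactSupport.mul_left (((hci i).fderiv_apply ℝ _))
  have i2 : ∀ i, Integrable (fun x => fderiv ℝ v x (EuclideanSpace.single i 1) * Θ x i) :=
    fun i => by
    apply Continuous.integrable_of_hasCompactSupport
    · have := (hcd i).continuous
      fun_prop
    · exact HasCompactSupport.mul_left (hci i)
  have i3 : ∀ i, Integrable (fun x => v x * Θ x i) :=
    fun i => by
    apply Continuous.integrable_of_hasCompactSupport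
    · have := (hcd i).continuous
      fun_prop
    · exact HasCompactSupport.mul_left (hci i)
  simp_rw [divg_eq hΘ, clm_eq_sum (fderiv ℝ v _) (Θ _), Finset.mul_sum]
  rw [integral_finsetSum _ fun i _ => i1 i, integral_finsetSum _ fun i _ => i2 i,
    ← Finset.sum_neg_distrib]
  refine Finset.sum_congr rfl fun i _ => ?_
  exact integral_mul_fderiv_eq_neg_fderiv_mul_of_integrable (i2 i) (i1 i) (i3 i)
    (fun x _ => (hv.differentiable (by simp)).differentiableAt)
    (fun x _ => ((hcd i).differentiable (by simp)).differentiableAt)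

/-- transposed mollification of a field -/
def MoT {n : ℕ} (κ : Eu n → ℝ) (Θ : Eu n → Eu n) : Eu n → Eu n :=
  MeasureTheory.convolution (fun t => κ (-t)) Θ (ContinuousLinearMap.lsmul ℝ ℝ) volume

lemma MoT_apply {n : ℕ} (κ : Eu n → ℝ) (Θ : Eu n → Eu n) (y : Eu n) :
    MoT κ Θ y = ∫ t, κ (-t) • Θ (y - t) := rfl

lemma ker_neg_integrable {n : ℕ} {κ : Eu n → ℝ} {δ : ℝ} (hκ : IsKer κ δ) :
    Integrable (fun t => κ (-t)) := hκ.integrable.comp_neg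

lemma MoT_divg {n : ℕ} {κ : Eu n → ℝ} {δ : ℝ} (hκ : IsKer κ δ) {Θ : Eu n → Eu n}
    (hΘ : ContDiff ℝ 1 Θ) (hc : HasCompactSupport Θ) (y : Eu n) :
    divg (MoT κ Θ) y = ∫ x, κ (x - y) * divg Θ x := by
  have h1 := (hc.hasFDerivAt_convolution_right (ContinuousLinearMap.lsmul ℝ ℝ)
    (ker_neg_integrable hκ).locallyIntegrable hΘ y).fderiv
  have h2 : ∀ i, fderiv ℝ (MoT κ Θ) y (EuclideanSpace.single i 1) i =
      ∫ t, κ (-t) * fderiv ℝ Θ (y - t) (EuclideanSpace.single i 1) i := by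
    intro i
    have hcf : Continuous (fderiv ℝ Θ) := hΘ.continuous_fderiv (by simp)
    have e : fderiv ℝ (MoT κ Θ) y = ∫ t, κ (-t) • fderiv ℝ Θ (y - t) := by
      unfold MoT
      rw [h1]
      unfold MeasureTheory.convolution
      congr 1
    obtain ⟨B, -, hB⟩ := bounded_of_hcs hcf (hc.fderiv ℝ)
    have hIntg : Integrable (fun t => κ (-t) • fderiv ℝ Θ (y - t)) := by
      refine (ker_neg_integrable hκ).smul_bdd (C := B) ?_ ?_
      · exact (hcf.comp (by fun_prop)).aestronglyMeasurable
      · exact Eventually.of_forall fun t => hB _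
    let T : (Eu n →L[ℝ] Eu n) →L[ℝ] ℝ :=
      (EuclideanSpace.proj i : Eu n →L[ℝ] ℝ).comp
        (ContinuousLinearMap.apply ℝ (Eu n) (EuclideanSpace.single i 1))
    have := T.integral_comp_comm hIntg
    rw [e]
    simpa [T] using this.symm
  have hcf : Continuous (fderiv ℝ Θ) := hΘ.continuous_fderiv (by simp)
  have hIntg : ∀ i, Integrable (fun t => κ (-t) *
      fderiv ℝ Θ (y - t) (EuclideanSpace.single i 1) i) := by
    intro i
    have hcm : HasCompactSupport (fun t => κ (-t)) := hκ.hcs.comp_homeomorph (Homeomorph.neg _)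
    apply Continuous.integrable_of_hasCompactSupport
    · have := hκ.smooth.continuous
      fun_prop
    · exact hcm.mul_right
  unfold divg
  simp_rw [h2]
  rw [← integral_finsetSum _ fun i _ => hIntg i]
  simp_rw [← Finset.mul_sum]
  rw [← integral_sub_left_eq_self (fun x => κ (x - y) *
    ∑ i, fderiv ℝ Θ x (EuclideanSpace.single i 1) i) volume y]
  congr 1
  ext t
  congr 2
  abel

lemma MoT_test {n : ℕ} {κ : Eu n → ℝ} {δ : ℝ} (hκ : IsKer κ δ) {Θ : Eu n → Eu n} {V U : Set (Eu n)}
    (hΘ : IsTest V Θ) (hU : ∀ x ∈ tsupport Θ, Metric.closedBall x δ ⊆ U) :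
    IsTest U (MoT κ Θ) := by
  have hcomp : IsCompact (Metric.closedBall (0 : Eu n) δ + tsupport Θ) :=
    (isCompact_closedBall 0 δ).add hΘ.hcs
  have hs : Function.support (MoT κ Θ) ⊆ Metric.closedBall (0 : Eu n) δ + tsupport Θ := by
    refine (support_convolution_subset (L := ContinuousLinearMap.lsmul ℝ ℝ)).trans ?_
    refine Set.add_subset_add ?_ subset_closure
    intro t ht
    by_contra h
    apply ht
    apply hκ.supp
    simpa using h
  have hts : tsupport (MoT κ Θ) ⊆ Metric.closedBall (0 : Eu n) δ + tsupport Θ :=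
    closure_minimal hs hcomp.isClosed
  refine ⟨?_, ?_, ?_, ?_⟩
  · exact hΘ.hcs.contDiff_convolution_right (n := 1) _ (ker_neg_integrable hκ).locallyIntegrable hΘ.cd
  · exact hcomp.of_isClosed_subset (isClosed_tsupport _) hts
  · refine hts.trans ?_
    rintro _ ⟨a, ha, b, hb, rfl⟩
    apply hU b hb
    simpa [dist_eq_norm] using ha
  · intro y
    rw [MoT_apply]
    calc ‖∫ t, κ (-t) • Θ (y - t)‖ ≤ ∫ t, κ (-t) := by
          refine norm_integral_le_of_norm_le (ker_neg_integrable hκ)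
            (Eventually.of_forall fun t => ?_)
          rw [norm_smul, Real.norm_of_nonneg (hκ.nonneg _)]
          exact mul_le_of_le_one_right (hκ.nonneg _) (hΘ.le _)
      _ = 1 := by rw [integral_neg_eq_self (fun t => κ t), hκ.int]

lemma Mo_pair {n : ℕ} {κ : Eu n → ℝ} {δ : ℝ} (hκ : IsKer κ δ) {h D : Eu n → ℝ} (hh : Integrable h)
    (hD : Integrable D) :
    ∫ x, Mo κ h x * D x = ∫ y, h y * ∫ x, κ (x - y) * D x := by
  unfold Mo
  simp_rw [← integral_mul_const, ← integral_const_mul]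
  rw [integral_integral_swap]
  · congr 1; ext y; congr 1; ext x; ring
  · obtain ⟨B, -, hB⟩ := bounded_of_hcs hκ.smooth.continuous hκ.hcs
    have h1 : Integrable (fun z : Eu n × Eu n => D z.1 * h z.2) (volume.prod volume) :=
      hD.mul_prod hh
    have h2 := h1.bdd_mul (f := fun z : Eu n × Eu n => κ (z.1 - z.2)) (c := B) 
      ((hκ.smooth.continuous.comp (by fun_prop)).aestronglyMeasurable)
      (Eventually.of_forall fun z => hB _)
    refine h2.congr (Eventually.of_forall fun z => ?_)
    simp only [Function.uncurry]
    ring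

lemma Mo_le_tv {n : ℕ} {κ : Eu n → ℝ} {δ : ℝ} (hκ : IsKer κ δ) {Θ : Eu n → Eu n}
    {V U : Set (Eu n)} {h : Eu n → ℝ} (hh : Integrable h)
    (hΘ : IsTest V Θ) (hU : ∀ x ∈ tsupport Θ, Metric.closedBall x δ ⊆ U) :
    ENNReal.ofReal (∫ x, Mo κ h x * divg Θ x) ≤ totVarOpen U h := by
  rw [Mo_pair hκ hh ((divg_continuous hΘ.cd).integrable_of_hasCompactSupport (divg_hcs hΘ.hcs))]
  simp_rw [← MoT_divg hκ hΘ.cd hΘ.hcs]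
  exact le_tv (MoT_test hκ hΘ hU) h

lemma Mo_tv_le {n : ℕ} {κ : Eu n → ℝ} {δ : ℝ} (hκ : IsKer κ δ) 
    {V U : Set (Eu n)} {h : Eu n → ℝ} (hh : Integrable h)
    (hU : ∀ x ∈ V, Metric.closedBall x δ ⊆ U) :
    totVarOpen V (Mo κ h) ≤ totVarOpen U h :=
  tv_le fun _ hΘ => Mo_le_tv hκ hh hΘ fun x hx => hU x (hΘ.sub hx)


def MoE {n : ℕ} (κ : Eu n → ℝ) (H : Eu n → ℝ≥0∞) (x : Eu n) : ℝ≥0∞ :=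
  ∫⁻ y, ENNReal.ofReal (κ (x - y)) * H y

lemma ker_int_sub {n : ℕ} {κ : Eu n → ℝ} {δ : ℝ} (hκ : IsKer κ δ) (x : Eu n) :
    ∫ y, κ (x - y) = 1 := by
  rw [integral_sub_left_eq_self (fun z => κ z) volume x, hκ.int]

lemma ker_lint {n : ℕ} {κ : Eu n → ℝ} {δ : ℝ} (hκ : IsKer κ δ) :
    ∫⁻ y, ENNReal.ofReal (κ y) = 1 := by
  rw [← ofReal_integral_eq_lintegral_ofReal hκ.integrable (Eventually.of_forall hκ.nonneg), hκ.int,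
    ENNReal.ofReal_one]

lemma ker_lint_sub {n : ℕ} {κ : Eu n → ℝ} {δ : ℝ} (hκ : IsKer κ δ) (x : Eu n) :
    ∫⁻ y, ENNReal.ofReal (κ (x - y)) = 1 := by
  rw [lintegral_sub_left_eq_self (fun z => ENNReal.ofReal (κ z)) x, ker_lint hκ]

lemma ker_lint_sub' {n : ℕ} {κ : Eu n → ℝ} {δ : ℝ} (hκ : IsKer κ δ) (y : Eu n) :
    ∫⁻ x, ENNReal.ofReal (κ (x - y)) = 1 := by
  rw [lintegral_sub_right_eq_self (fun z => ENNReal.ofReal (κ z)) y, ker_lint hκ]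

lemma MoE_aem {n : ℕ} {κ : Eu n → ℝ} {δ : ℝ} (hκ : IsKer κ δ) {H : Eu n → ℝ≥0∞}
    (hH : AEMeasurable H) : AEMeasurable (fun z : Eu n × Eu n =>
      ENNReal.ofReal (κ (z.1 - z.2)) * H z.2) (volume.prod volume) := by
  have h1 : Measurable (fun z : Eu n × Eu n => ENNReal.ofReal (κ (z.1 - z.2))) := by
    have : Continuous (fun z : Eu n × Eu n => κ (z.1 - z.2)) :=
      hκ.smooth.continuous.comp (by fun_prop)
    exact this.measurable.ennreal_ofReal
  exact h1.aemeasurable.mul (hH.comp_snd)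

lemma MoE_lint {n : ℕ} {κ : Eu n → ℝ} {δ : ℝ} (hκ : IsKer κ δ) {H : Eu n → ℝ≥0∞}
    (hH : AEMeasurable H) : ∫⁻ x, MoE κ H x = ∫⁻ x, H x := by
  unfold MoE
  rw [lintegral_lintegral_swap (MoE_aem hκ hH)]
  congr 1
  ext y
  rw [lintegral_mul_const, ker_lint_sub' hκ, one_mul]
  exact (hκ.smooth.continuous.comp (by fun_prop)).measurable.ennreal_ofReal

lemma Mo_enorm_le {n : ℕ} {κ : Eu n → ℝ} {δ : ℝ} (hκ : IsKer κ δ) (k : Eu n → ℝ) (x : Eu n) :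
    ‖Mo κ k x‖ₑ ≤ MoE κ (fun y => ‖k y‖ₑ) x := by
  unfold Mo MoE
  refine (enorm_integral_le_lintegral_enorm _).trans (le_of_eq ?_)
  congr 1; ext y
  rw [enorm_mul, Real.enorm_of_nonneg (hκ.nonneg _)]

lemma Mo_sub {n : ℕ} {κ : Eu n → ℝ} {δ : ℝ} (hκ : IsKer κ δ) {h k : Eu n → ℝ} (hh : Integrable h)
    (hk : Integrable k) (x : Eu n) : Mo κ (fun y => h y - k y) x = Mo κ h x - Mo κ k x := by
  unfold Mo
  rw [← integral_sub (Mo_integrand_integrable hκ hh x) (Mo_integrand_integrable hκ hk x)]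
  congr 1; ext y; ring

lemma Mo_add {n : ℕ} {κ : Eu n → ℝ} {δ : ℝ} (hκ : IsKer κ δ) {h k : Eu n → ℝ} (hh : Integrable h)
    (hk : Integrable k) (x : Eu n) : Mo κ (fun y => h y + k y) x = Mo κ h x + Mo κ k x := by
  unfold Mo
  rw [← integral_add (Mo_integrand_integrable hκ hh x) (Mo_integrand_integrable hκ hk x)]
  congr 1; ext y; ring

lemma Mo_L1 {n : ℕ} {φ : Eu n → ℝ} (hφ : IsKer φ 1) {h : Eu n → ℝ} (hh : Integrable h) :
    Tendsto (fun δ : ℝ => ∫⁻ x, ‖Mo (scaleKer φ δ) h x - h x‖ₑ) (𝓝[>] 0) (𝓝 0) := by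
  rw [ENNReal.tendsto_nhds_zero]
  intro ε hε
  obtain ⟨ε', hε', hε'2⟩ : ∃ ε' : ℝ≥0∞, ε' ≠ 0 ∧ ε' + ε' + ε' ≤ ε := by
    refine ⟨ε / 3, by simp [hε.ne'], le_of_eq ?_⟩
    exact ENNReal.add_thirds ε
  obtain ⟨g, hgc, hgh, hgcont, hgi⟩ := hh.exists_hasCompactSupport_lintegral_sub_le hε'
  obtain ⟨R, hR⟩ := hgc.isCompact.isBounded.subset_closedBall (0 : Eu n)
  set m : ℝ≥0∞ := volume (Metric.closedBall (0 : Eu n) (R + 1)) with hm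
  have hmt : m ≠ ⊤ := measure_closedBall_lt_top.ne
  obtain ⟨η, hη, hηm⟩ : ∃ η : ℝ, 0 < η ∧ ENNReal.ofReal η * m ≤ ε' := by
    obtain ⟨η, h0, h1⟩ := ENNReal.exists_nnreal_pos_mul_lt hmt hε'
    exact ⟨η, h0, by simpa using h1.le⟩
  have huc := hgc.uniformContinuous_of_continuous hgcont
  rw [Metric.uniformContinuous_iff] at huc
  obtain ⟨r, hr, hrg⟩ := huc η hη
  have hev : Ioo (0 : ℝ) (min 1 r) ∈ 𝓝[>] (0 : ℝ) := Ioo_mem_nhdsGT (by positivity)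
  filter_upwards [hev] with δ hδ
  have hκ := scaleKer_isKer hφ hδ.1
  have hδ1 : δ < 1 := hδ.2.trans_le (min_le_left _ _)
  have hδr : δ < r := hδ.2.trans_le (min_le_right _ _)
  set κ := scaleKer φ δ
  have hA : ∀ x, ‖Mo κ g x - g x‖ₑ ≤
      (Metric.closedBall (0 : Eu n) (R + 1)).indicator (fun _ => ENNReal.ofReal η) x := by
    intro x
    have e1 : Mo κ g x - g x = ∫ y, κ (x - y) * (g y - g x) := by
      have : g x = ∫ y, κ (x - y) * g x := by
        rw [integral_mul_const, ker_int_sub hκ, one_mul]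
      conv_lhs => rw [this]
      unfold Mo
      rw [← integral_sub (Mo_integrand_integrable hκ hgi x)
        ((hκ.integrable.comp_sub_left x).mul_const _)]
      congr 1; ext y; ring
    by_cases hx : x ∈ Metric.closedBall (0 : Eu n) (R + 1)
    · rw [indicator_of_mem hx, ← ofReal_norm]
      apply ENNReal.ofReal_le_ofReal
      rw [e1]
      calc ‖∫ y, κ (x - y) * (g y - g x)‖ ≤ ∫ y, κ (x - y) * η := by
            refine norm_integral_le_of_norm_le ((hκ.integrable.comp_sub_left x).mul_const _)
              (Eventually.of_forall fun y => ?_)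
            rw [norm_mul, Real.norm_of_nonneg (hκ.nonneg _)]
            by_cases hy : δ < ‖x - y‖
            · simp [hκ.supp _ hy]
            · refine mul_le_mul_of_nonneg_left ?_ (hκ.nonneg _)
              rw [← dist_eq_norm]
              refine (hrg ?_).le
              rw [dist_comm, dist_eq_norm]
              linarith
        _ = η := by rw [integral_mul_const, ker_int_sub hκ, one_mul]
    · rw [indicator_of_notMem hx, e1]
      have : ∀ y, κ (x - y) * (g y - g x) = 0 := by
        intro y
        have hx' : R + 1 < ‖x‖ := by simpa using hx
        have gz : ∀ z, R < ‖z‖ → g z = 0 := fun z hz => by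
          by_contra h0
          have := hR (subset_tsupport _ h0)
          simp at this
          linarith
        by_cases hy : δ < ‖x - y‖
        · simp [hκ.supp _ hy]
        · have : ‖x‖ ≤ ‖x - y‖ + ‖y‖ := by simpa using norm_add_le (x - y) y
          rw [gz x (by linarith), gz y (by linarith)]
          simp
      simp [this]
  have hB : ∀ x, ‖Mo κ h x - h x‖ₑ ≤ MoE κ (fun y => ‖h y - g y‖ₑ) x + ‖Mo κ g x - g x‖ₑ +
      ‖h x - g x‖ₑ := by
    intro x
    have e : Mo κ h x - h x = Mo κ (fun y => h y - g y) x + (Mo κ g x - g x) + - (h x - g x) := by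
      rw [Mo_sub hκ hh hgi]; ring
    rw [e]
    refine (enorm_add_le _ _).trans ?_
    rw [enorm_neg]
    gcongr
    refine (enorm_add_le _ _).trans ?_
    gcongr
    exact Mo_enorm_le hκ _ x
  have hm1 : AEMeasurable (fun y => ‖h y - g y‖ₑ) := (hh.sub hgi).aestronglyMeasurable.enorm
  calc ∫⁻ x, ‖Mo κ h x - h x‖ₑ ≤ ∫⁻ x, (MoE κ (fun y => ‖h y - g y‖ₑ) x + ‖Mo κ g x - g x‖ₑ +
      ‖h x - g x‖ₑ) := lintegral_mono hB
    _ = (∫⁻ x, MoE κ (fun y => ‖h y - g y‖ₑ) x) + (∫⁻ x, ‖Mo κ g x - g x‖ₑ) +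
      ∫⁻ x, ‖h x - g x‖ₑ := by
        rw [lintegral_add_right' _ hm1, lintegral_add_right']
        exact ((Mo_contDiff hκ hgi).continuous.sub hgcont).enorm.aemeasurable
    _ ≤ ε' + ε' + ε' := by
        rw [MoE_lint hκ hm1]
        gcongr
        calc ∫⁻ x, ‖Mo κ g x - g x‖ₑ ≤ _ := lintegral_mono hA
          _ = ENNReal.ofReal η * m := by
            rw [lintegral_indicator measurableSet_closedBall]
            simp [hm]
          _ ≤ ε' := hηm
    _ ≤ ε := hε'2


def ar (k t : ℝ) : ℝ := k * Real.arctan (t / k)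

def ar' (k t : ℝ) : ℝ := 1 / (1 + (t / k) ^ 2)

lemma ar_hasDeriv {k : ℝ} (hk : 0 < k) (t : ℝ) : HasDerivAt (ar k) (ar' k t) t := by
  have := (((hasDerivAt_id t).div_const k).arctan).const_mul k
  have e : ar' k t = k * (1 / (1 + (id t / k) ^ 2) * (1 / k)) := by
    unfold ar'
    simp only [id]
    field_simp
  rw [e]
  exact this

lemma ar'_nonneg (k t : ℝ) : 0 ≤ ar' k t := by unfold ar'; positivity

lemma ar'_le (k t : ℝ) : ar' k t ≤ 1 := by
  unfold ar'
  rw [div_le_one (by positivity)]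
  nlinarith [sq_nonneg (t / k)]

lemma ar'_contDiff (k : ℝ) : ContDiff ℝ 1 (ar' k) := by
  unfold ar'
  refine contDiff_const.div (by fun_prop) fun t => by positivity

lemma ar_contDiff (k : ℝ) : ContDiff ℝ 1 (ar k) := by
  unfold ar
  exact contDiff_const.mul (Real.contDiff_arctan.comp (by fun_prop))

lemma ar_lip {k : ℝ} (hk : 0 < k) : LipschitzWith 1 (ar k) := by
  refine lipschitzWith_of_nnnorm_deriv_le (fun t => (ar_hasDeriv hk t).differentiableAt) fun t => ?_
  rw [(ar_hasDeriv hk t).deriv, ← NNReal.coe_le_coe, coe_nnnorm, Real.norm_of_nonneg (ar'_nonneg _ _)]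
  exact ar'_le _ _

lemma arc_hasDeriv {k : ℝ} (hk : 0 < k) (t : ℝ) :
    HasDerivAt (fun s => s - ar k s) (1 - ar' k t) t := (hasDerivAt_id t).sub (ar_hasDeriv hk t)

lemma arc_lip {k : ℝ} (hk : 0 < k) : LipschitzWith 1 (fun t => t - ar k t) := by
  refine lipschitzWith_of_nnnorm_deriv_le (fun t => (arc_hasDeriv hk t).differentiableAt) fun t => ?_
  have := ar'_nonneg k t
  have := ar'_le k t
  rw [(arc_hasDeriv hk t).deriv, ← NNReal.coe_le_coe, coe_nnnorm, Real.norm_of_nonneg (by linarith)]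
  simpa using by linarith

lemma ar_zero (k : ℝ) : ar k 0 = 0 := by simp [ar]

lemma lip_abs_le {f : ℝ → ℝ} (hf : LipschitzWith 1 f) (h0 : f 0 = 0) (t : ℝ) : |f t| ≤ |t| := by
  have := hf.dist_le_mul t 0
  simpa [h0, Real.dist_eq] using this

lemma ar_bdd {k : ℝ} (hk : 0 < k) (t : ℝ) : |ar k t| ≤ k * 2 := by
  unfold ar
  rw [abs_mul, abs_of_pos hk]
  gcongr
  have := Real.pi_le_four
  rw [abs_le]
  constructor <;> linarith [Real.arctan_lt_pi_div_two (t / k), Real.neg_pi_div_two_lt_arctan (t / k)]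

lemma ar_tendsto (t : ℝ) : Tendsto (fun j : ℕ => ar ((j : ℝ) + 1) t) atTop (𝓝 t) := by
  by_cases ht : t = 0
  · simp [ht, ar_zero]
  have h1 : Tendsto (fun j : ℕ => t / ((j : ℝ) + 1)) atTop (𝓝[≠] 0) := by
    rw [tendsto_nhdsWithin_iff]
    constructor
    · have := (tendsto_one_div_add_atTop_nhds_zero_nat (𝕜 := ℝ)).const_mul t
      simpa [div_eq_mul_inv] using this
    · refine Eventually.of_forall fun j => ?_
      have : (j : ℝ) + 1 ≠ 0 := by positivity
      simp [ht, this]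
  have h2 := (Real.hasDerivAt_arctan 0).tendsto_slope_zero
  have h3 := (h2.comp h1).const_mul t
  simp at h3
  refine h3.congr fun j => ?_
  unfold ar
  have : (j : ℝ) + 1 ≠ 0 := by positivity
  field_simp

lemma lip_comp_integrable {n : ℕ} {h : Eu n → ℝ} (hh : Integrable h) {f : ℝ → ℝ}
    (hf : LipschitzWith 1 f) (h0 : f 0 = 0) : Integrable (fun x => f (h x)) :=
  hh.mono (hf.continuous.comp_aestronglyMeasurable hh.aestronglyMeasurable)
    (Eventually.of_forall fun x => lip_abs_le hf h0 (h x))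

lemma Mo_integrable {n : ℕ} {κ : Eu n → ℝ} {δ : ℝ} (hκ : IsKer κ δ) {h : Eu n → ℝ}
    (hh : Integrable h) : Integrable (Mo κ h) := by
  refine ⟨(Mo_contDiff hκ hh).continuous.aestronglyMeasurable, ?_⟩
  refine (lintegral_mono (Mo_enorm_le hκ h)).trans_lt ?_
  rw [MoE_lint hκ hh.aestronglyMeasurable.enorm]
  exact hh.2

lemma lip_pair_tendsto {n : ℕ} {φ : Eu n → ℝ} (hφ : IsKer φ 1) {h : Eu n → ℝ} (hh : Integrable h)
    {f : ℝ → ℝ} (hf : LipschitzWith 1 f) (h0 : f 0 = 0) {D : Eu n → ℝ} (hD : Continuous D)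
    (hDc : HasCompactSupport D) :
    Tendsto (fun δ : ℝ => ∫ x, f (Mo (scaleKer φ δ) h x) * D x) (𝓝[>] 0)
      (𝓝 (∫ x, f (h x) * D x)) := by
  obtain ⟨B, hB1, hB⟩ := bounded_of_hcs hD hDc
  have key : ∀ k : Eu n → ℝ, Integrable k → Integrable (fun x => f (k x) * D x) := by
    intro k hk
    exact (lip_comp_integrable hk hf h0).mul_bdd (c := B) hD.aestronglyMeasurable
      (Eventually.of_forall hB)
  apply tendsto_integral_of_L1 _ (key h hh).aestronglyMeasurable
  · filter_upwards [self_mem_nhdsWithin] with δ hδ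
    exact key _ (Mo_integrable (scaleKer_isKer hφ hδ) hh)
  · have h1 := ENNReal.Tendsto.const_mul (a := ENNReal.ofReal B) (Mo_L1 hφ hh) (Or.inr (by simp))
    rw [mul_zero] at h1
    refine tendsto_of_tendsto_of_tendsto_of_le_of_le tendsto_const_nhds h1 (fun _ => zero_le) ?_
    intro δ
    show _ ≤ ENNReal.ofReal B * ∫⁻ x, _
    rw [← lintegral_const_mul' _ _ (by simp)]
    refine lintegral_mono fun x => ?_
    rw [← ofReal_norm, ← ofReal_norm, ← ENNReal.ofReal_mul (by linarith)]
    apply ENNReal.ofReal_le_ofReal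
    rw [← sub_mul, norm_mul, mul_comm]
    have := hf.dist_le_mul (Mo (scaleKer φ δ) h x) (h x)
    simp only [Real.dist_eq, NNReal.coe_one, one_mul] at this
    exact mul_le_mul (hB x) this (norm_nonneg _) (by linarith)

lemma trunc_pair {n : ℕ} {κ : Eu n → ℝ} {δ : ℝ} (hκ : IsKer κ δ) {U : Set (Eu n)}
    {h : Eu n → ℝ} (hh : Integrable h) (hT : totVarOpen U h ≠ ⊤)
    {Θ Ψ : Eu n → Eu n} (hΘ : IsTest U Θ) (hΨ : IsTest U Ψ)
    (hU : ∀ x ∈ tsupport Θ ∪ tsupport Ψ, Metric.closedBall x δ ⊆ U) {k : ℝ} (hk : 0 < k) :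
    (∫ x, ar k (Mo κ h x) * divg Θ x) + (∫ x, (Mo κ h x - ar k (Mo κ h x)) * divg Ψ x) ≤
      (totVarOpen U h).toReal := by
  set v := Mo κ h with hv
  have hvc : ContDiff ℝ 1 v := (Mo_contDiff hκ hh).of_le (by simp)
  have hvd : ∀ x, HasFDerivAt v (fderiv ℝ v x) x := fun x =>
    (hvc.differentiable (by simp)).differentiableAt.hasFDerivAt
  set Ξ : Eu n → Eu n := fun x => ar' k (v x) • Θ x + (1 - ar' k (v x)) • Ψ x with hΞ
  have hap : ContDiff ℝ 1 (fun x => ar' k (v x)) := (ar'_contDiff k).comp hvc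
  have hts : tsupport Ξ ⊆ tsupport Θ ∪ tsupport Ψ := by
    refine closure_minimal ?_ ((isClosed_tsupport _).union (isClosed_tsupport _))
    intro x hx
    by_contra hcon
    rw [mem_union, not_or] at hcon
    apply hx
    simp [hΞ, image_eq_zero_of_notMem_tsupport hcon.1, image_eq_zero_of_notMem_tsupport hcon.2]
  have hΞt : IsTest U Ξ := by
    refine ⟨?_, ?_, ?_, ?_⟩
    · exact (hap.smul hΘ.cd).add ((contDiff_const.sub hap).smul hΨ.cd)
    · exact (hΘ.hcs.isCompact.union hΨ.hcs.isCompact).of_isClosed_subset (isClosed_tsupport _) hts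
    · exact hts.trans (union_subset hΘ.sub hΨ.sub)
    · intro x
      have a := ar'_nonneg k (v x)
      have b := ar'_le k (v x)
      calc ‖Ξ x‖ ≤ ‖ar' k (v x) • Θ x‖ + ‖(1 - ar' k (v x)) • Ψ x‖ := norm_add_le _ _
        _ = ar' k (v x) * ‖Θ x‖ + (1 - ar' k (v x)) * ‖Ψ x‖ := by
          rw [norm_smul, norm_smul, Real.norm_of_nonneg a, Real.norm_of_nonneg (by linarith)]
        _ ≤ ar' k (v x) * 1 + (1 - ar' k (v x)) * 1 := by
          gcongr
          · exact hΘ.le x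
          · exact hΨ.le x
        _ = 1 := by ring
  have d1 : ∀ x, fderiv ℝ (fun x => ar k (v x)) x = ar' k (v x) • fderiv ℝ v x := fun x =>
    ((ar_hasDeriv hk (v x)).comp_hasFDerivAt x (hvd x)).fderiv
  have d2 : ∀ x, fderiv ℝ (fun x => v x - ar k (v x)) x = (1 - ar' k (v x)) • fderiv ℝ v x :=
    fun x => ((arc_hasDeriv hk (v x)).comp_hasFDerivAt x (hvd x)).fderiv
  have c1 : ContDiff ℝ 1 (fun x => ar k (v x)) := (ar_contDiff k).comp hvc
  have hfc := hvc.continuous_fderiv (by simp)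
  have hapc := hap.continuous
  have i1 : Integrable (fun x => ar' k (v x) * fderiv ℝ v x (Θ x)) := by
    have := hΘ.cd.continuous
    apply Continuous.integrable_of_hasCompactSupport (by fun_prop)
    refine HasCompactSupport.intro hΘ.hcs fun x hx => ?_
    simp [image_eq_zero_of_notMem_tsupport hx]
  have i2 : Integrable (fun x => (1 - ar' k (v x)) * fderiv ℝ v x (Ψ x)) := by
    have := hΨ.cd.continuous
    apply Continuous.integrable_of_hasCompactSupport (by fun_prop)
    refine HasCompactSupport.intro hΨ.hcs fun x hx => ?_
    simp [image_eq_zero_of_notMem_tsupport hx]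
  have e : (∫ x, ar k (v x) * divg Θ x) + (∫ x, (v x - ar k (v x)) * divg Ψ x) =
      ∫ x, v x * divg Ξ x := by
    rw [ibp hvc hΞt.cd hΞt.hcs, ibp c1 hΘ.cd hΘ.hcs, ibp (hvc.sub c1) hΨ.cd hΨ.hcs]
    simp_rw [d1, d2]
    simp only [_root_.smul_apply, smul_eq_mul, hΞ, map_add, map_smul]
    rw [integral_add i1 i2]
    ring
  rw [e]
  have := Mo_le_tv hκ hh hΞt fun x hx => hU x (hts hx)
  rw [← ENNReal.ofReal_le_iff_le_toReal hT]
  exact this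

lemma trunc {n : ℕ} {φ : Eu n → ℝ} (hφ : IsKer φ 1) {U : Set (Eu n)} (hUo : IsOpen U)
    {h : Eu n → ℝ} (hh : Integrable h) (hT : totVarOpen U h ≠ ⊤) {ε : ℝ} (hε : 0 < ε) :
    ∃ k : ℝ, 0 < k ∧ totVarOpen U (fun x => h x - ar k (h x)) ≤ ENNReal.ofReal ε := by
  set T := (totVarOpen U h).toReal with hTdef
  obtain ⟨Θ, hΘ, hlt⟩ : ∃ Θ, IsTest U Θ ∧ T - ε / 2 < ∫ x, h x * divg Θ x := by
    by_contra hcon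
    push Not at hcon
    have hz : IsTest U (fun _ => (0 : Eu n)) := by
      refine ⟨contDiff_const, HasCompactSupport.zero, ?_, by simp⟩
      have : tsupport (fun _ : Eu n => (0 : Eu n)) = ∅ := by
        rw [tsupport_eq_empty_iff]; rfl
      simp [this]
    have h1 := hcon _ hz
    have h2 : totVarOpen U h ≤ ENNReal.ofReal (T - ε / 2) :=
      tv_le fun Θ hΘ => ENNReal.ofReal_le_ofReal (hcon Θ hΘ)
    have h3 : 0 ≤ T - ε / 2 := by
      have : ∀ x, divg (fun _ : Eu n => (0 : Eu n)) x = 0 := fun x => by simp [divg]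
      simpa [this] using h1
    have h4 := ENNReal.toReal_mono (by simp) h2
    rw [ENNReal.toReal_ofReal h3] at h4
    linarith
  have hdc := divg_continuous hΘ.cd
  obtain ⟨B, hB1, hB⟩ := bounded_of_hcs hdc (divg_hcs hΘ.hcs)
  have hlim : Tendsto (fun j : ℕ => ∫ x, ar ((j : ℝ) + 1) (h x) * divg Θ x) atTop
      (𝓝 (∫ x, h x * divg Θ x)) := by
    apply tendsto_integral_of_dominated_convergence (fun x => |h x| * |divg Θ x|)
    · intro j
      exact ((ar_contDiff _).continuous.comp_aestronglyMeasurable hh.aestronglyMeasurable).mul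
        hdc.aestronglyMeasurable
    · refine hh.abs.mul_bdd (c := B) hdc.abs.aestronglyMeasurable (Eventually.of_forall fun x => ?_)
      simpa using hB x
    · intro j
      refine Eventually.of_forall fun x => ?_
      rw [norm_mul]
      refine mul_le_mul_of_nonneg_right ?_ (norm_nonneg _)
      exact lip_abs_le (ar_lip (by positivity)) (ar_zero _) _
    · exact Eventually.of_forall fun x => (ar_tendsto (h x)).mul_const _
  obtain ⟨j, hj⟩ := (hlim.eventually (lt_mem_nhds hlt)).exists
  have hk : (0 : ℝ) < (j : ℝ) + 1 := by positivity
  refine ⟨(j : ℝ) + 1, hk, ?_⟩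
  set k := (j : ℝ) + 1
  refine tv_le fun Ψ hΨ => ENNReal.ofReal_le_ofReal ?_
  have l1 := lip_pair_tendsto hφ hh (ar_lip hk) (ar_zero k) hdc (divg_hcs hΘ.hcs)
  have l2 := lip_pair_tendsto hφ hh (arc_lip hk) (by simp [ar_zero]) (divg_continuous hΨ.cd)
    (divg_hcs hΨ.hcs)
  have l3 := le_of_tendsto (b := T) (l1.add l2) ?_
  · linarith
  · obtain ⟨r, hr, hrU⟩ := (hΘ.hcs.isCompact.union hΨ.hcs.isCompact).exists_cthickening_subset_open
      hUo (union_subset hΘ.sub hΨ.sub)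
    filter_upwards [Ioo_mem_nhdsGT hr] with δ hδ
    refine trunc_pair (scaleKer_isKer hφ hδ.1) hh hT hΘ hΨ ?_ hk
    intro x hx y hy
    apply hrU
    refine Metric.mem_cthickening_of_dist_le y x r _ hx ?_
    exact (Metric.mem_closedBall.1 hy).trans hδ.2.le


lemma exists_cutoff {n : ℕ} {K V : Set (Eu n)} (hK : IsCompact K) (hV : IsOpen V) (hKV : K ⊆ V) :
    ∃ χ : Eu n → ℝ, ContDiff ℝ 1 χ ∧ HasCompactSupport χ ∧ tsupport χ ⊆ V ∧
      (∀ x, 0 ≤ χ x ∧ χ x ≤ 1) ∧ ∀ x ∈ K, χ x = 1 := by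
  obtain ⟨r, hr, hrV⟩ := hK.exists_cthickening_subset_open hV hKV
  have hd : Disjoint (Metric.thickening r K)ᶜ K :=
    disjoint_left.2 fun x hx hxK => hx (Metric.self_subset_thickening hr K hxK)
  obtain ⟨f, hf0, hf1, hf⟩ := exists_contMDiffMap_zero_one_of_isClosed (n := 1) 𝓘(ℝ, Eu n)
    Metric.isOpen_thickening.isClosed_compl hK.isClosed hd
  have hts : tsupport f ⊆ Metric.cthickening r K := by
    refine closure_minimal ?_ Metric.isClosed_cthickening
    intro x hx
    by_contra hcon
    apply hx
    apply hf0
    intro h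
    exact hcon (Metric.thickening_subset_cthickening _ _ h)
  refine ⟨f, ?_, ?_, hts.trans hrV, fun x => ⟨(hf x).1, (hf x).2⟩, fun x hx => hf1 hx⟩
  · exact f.contMDiff.contDiff
  · exact hK.cthickening.of_isClosed_subset (isClosed_tsupport _) hts

def grd {n : ℕ} (v : Eu n → ℝ) (x : Eu n) : Eu n :=
  WithLp.toLp 2 fun i => fderiv ℝ v x (EuclideanSpace.single i 1)

lemma fderiv_eq_inner_grd {n : ℕ} (v : Eu n → ℝ) (x y : Eu n) :
    fderiv ℝ v x y = inner ℝ (grd v x) y := by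
  rw [clm_eq_sum (fderiv ℝ v x) y]
  simp [grd, PiLp.inner_apply, mul_comm]

lemma fderiv_le_grd {n : ℕ} (v : Eu n → ℝ) (x : Eu n) : ‖fderiv ℝ v x‖ ≤ ‖grd v x‖ := by
  refine ContinuousLinearMap.opNorm_le_bound _ (norm_nonneg _) fun y => ?_
  rw [fderiv_eq_inner_grd]
  exact norm_inner_le_norm _ _

lemma fderiv_grd {n : ℕ} (v : Eu n → ℝ) (x : Eu n) : fderiv ℝ v x (grd v x) = ‖grd v x‖ ^ 2 := by
  rw [fderiv_eq_inner_grd, real_inner_self_eq_norm_sq]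

lemma grd_contDiff {n : ℕ} {v : Eu n → ℝ} (hv : ContDiff ℝ (⊤ : ℕ∞) v) : ContDiff ℝ 1 (grd v) := by
  have h1 : ContDiff ℝ 1 (fderiv ℝ v) := hv.fderiv_right (by
    norm_cast)
  rw [contDiff_euclidean]
  intro i
  unfold grd
  simp only
  exact h1.clm_apply contDiff_const

lemma grad_le_tv {n : ℕ} {v : Eu n → ℝ} (hv : ContDiff ℝ (⊤ : ℕ∞) v) {K V : Set (Eu n)}
    (hK : IsCompact K) (hV : IsOpen V) (hKV : K ⊆ V) :
    ∫⁻ x in K, ‖fderiv ℝ v x‖ₑ ≤ totVarOpen V v := by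
  by_cases hT : totVarOpen V v = ⊤
  · simp [hT]
  obtain ⟨χ, hχ, hχc, hχV, hχ01, hχ1⟩ := exists_cutoff hK hV hKV
  have hg := grd_contDiff hv
  have hgc := hg.continuous
  have hv1 : ContDiff ℝ 1 v := hv.of_le (by simp)
  set I := ∫ x in K, ‖grd v x‖ with hI
  have hgi : IntegrableOn (fun x => ‖grd v x‖) K := hgc.norm.continuousOn.integrableOn_compact hK
  have key : ∀ ε : ℝ, 0 < ε → I ≤ (totVarOpen V v).toReal + ε * volume.real K := by
    intro ε hε
    set s : Eu n → ℝ := fun x => Real.sqrt (‖grd v x‖ ^ 2 + ε ^ 2) with hs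
    have hspos : ∀ x, 0 < s x := fun x => Real.sqrt_pos.2 (by positivity)
    have hsc : ContDiff ℝ 1 s := by
      refine ContDiff.sqrt ((hg.norm_sq ℝ).add contDiff_const) fun x => by positivity
    have hsle : ∀ x, s x ≤ ‖grd v x‖ + ε := fun x => by
      rw [hs]
      apply Real.sqrt_le_iff.2 ⟨by positivity, ?_⟩
      nlinarith [norm_nonneg (grd v x)]
    have hsge : ∀ x, ‖grd v x‖ ≤ s x := fun x => by
      rw [hs]
      apply Real.le_sqrt_of_sq_le
      nlinarith
    set Θ : Eu n → Eu n := fun x => (-(χ x * (s x)⁻¹)) • grd v x with hΘ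
    have hcd : ContDiff ℝ 1 Θ := by
      refine ContDiff.smul (hχ.mul (hsc.inv fun x => (hspos x).ne')).neg hg
    have hts : tsupport Θ ⊆ tsupport χ := by
      refine closure_minimal ?_ (isClosed_tsupport _)
      intro x hx
      by_contra hcon
      apply hx
      simp [hΘ, image_eq_zero_of_notMem_tsupport hcon]
    have hΘt : IsTest V Θ := by
      refine ⟨hcd, hχc.of_isClosed_subset (isClosed_tsupport _) hts, hts.trans hχV, fun x => ?_⟩
      simp only [hΘ]
      rw [norm_smul, norm_neg, norm_mul, norm_inv, Real.norm_of_nonneg (hχ01 x).1,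
        Real.norm_of_nonneg (hspos x).le, mul_assoc]
      have : (s x)⁻¹ * ‖grd v x‖ ≤ 1 := by
        rw [inv_mul_le_one₀ (hspos x)]
        exact hsge x
      have h0 : 0 ≤ (s x)⁻¹ * ‖grd v x‖ := mul_nonneg (inv_nonneg.2 (hspos x).le) (norm_nonneg _)
      nlinarith [(hχ01 x).1, (hχ01 x).2]
    have h1 := le_tv hΘt v
    rw [ibp hv1 hΘt.cd hΘt.hcs, ENNReal.ofReal_le_iff_le_toReal hT, ← integral_neg] at h1
    have e : ∀ x, -(fderiv ℝ v x (Θ x)) = χ x * ((s x)⁻¹ * ‖grd v x‖ ^ 2) := by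
      intro x
      simp only [hΘ, map_smul, smul_eq_mul, fderiv_grd]
      ring
    simp_rw [e] at h1
    have hnn : ∀ x, 0 ≤ χ x * ((s x)⁻¹ * ‖grd v x‖ ^ 2) := fun x =>
      mul_nonneg (hχ01 x).1 (mul_nonneg (inv_nonneg.2 (hspos x).le) (by positivity))
    have hIntg : Integrable (fun x => χ x * ((s x)⁻¹ * ‖grd v x‖ ^ 2)) := by
      apply Continuous.integrable_of_hasCompactSupport
      · exact hχ.continuous.mul
          ((hsc.continuous.inv₀ fun x => (hspos x).ne').mul (hgc.norm.pow 2))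
      · exact hχc.mul_right
    have h2 : ∫ x in K, (‖grd v x‖ - ε) ≤ ∫ x, χ x * ((s x)⁻¹ * ‖grd v x‖ ^ 2) := by
      refine le_trans ?_ (setIntegral_le_integral (s := K) hIntg (Eventually.of_forall hnn))
      refine setIntegral_mono_on (hgi.sub (by simp [hK.measure_lt_top])) hIntg.integrableOn hK.measurableSet
        fun x hx => ?_
      rw [hχ1 x hx, one_mul, ← div_eq_inv_mul, le_div_iff₀ (hspos x)]
      by_cases hle : ‖grd v x‖ ≤ ε
      · nlinarith [hspos x, sq_nonneg ‖grd v x‖]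
      · nlinarith [hsle x, hspos x, sq_nonneg ‖grd v x‖]
    have hci : IntegrableOn (fun _ : Eu n => ε) K := by simp [hK.measure_lt_top]
    rw [integral_sub hgi hci] at h2
    simp at h2
    linarith
  have hle : I ≤ (totVarOpen V v).toReal := by
    refine le_of_forall_pos_le_add fun η hη => ?_
    have hm : 0 ≤ volume.real K := measureReal_nonneg
    refine (key (η / (volume.real K + 1)) (by positivity)).trans ?_
    gcongr
    rw [div_mul_eq_mul_div, div_le_iff₀ (by positivity)]
    nlinarith
  rw [← ENNReal.ofReal_le_iff_le_toReal hT] at hle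
  refine le_trans ?_ hle
  rw [hI, ofReal_integral_eq_lintegral_ofReal hgi (Eventually.of_forall fun x => norm_nonneg _)]
  refine lintegral_mono fun x => ?_
  rw [← ofReal_norm]
  exact ENNReal.ofReal_le_ofReal (fderiv_le_grd v x)

lemma weakGrad_fix {n : ℕ} {W : Set (Eu n)} (hW : IsOpen W) {u : Eu n → ℝ} (hu : IntegrableOn u W)
    {g : Eu n → Eu n} (hg : IsWeakGrad W u g) :
    ∃ G : Eu n → Eu n, IsWeakGrad W u G ∧ (∀ x, ‖G x‖ ≤ ‖g x‖) ∧
      AEMeasurable G (volume.restrict W) := by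
  classical
  let P : Fin n → Prop := fun i => ∀ ψ : Eu n → ℝ, ContDiff ℝ 1 ψ → HasCompactSupport ψ →
    tsupport ψ ⊆ W → IntegrableOn (fun x => g x i * ψ x) W
  let G : Eu n → Eu n := fun x => WithLp.toLp 2 fun i => if P i then g x i else 0
  refine ⟨G, ?_, ?_, ?_⟩
  · intro ψ hψ hψc hψW i
    by_cases hP : P i
    · simp only [G, hP, if_true]
      exact hg ψ hψ hψc hψW i
    · simp only [G, hP, if_false, zero_mul, integral_zero, neg_zero]
      have hP' := hP
      simp only [P] at hP'
      push Not at hP'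
      obtain ⟨φ, hφ, hφc, hφW, hni⟩ := hP'
      have h1 := hg φ hφ hφc hφW i
      rw [integral_undef hni, neg_zero] at h1
      by_cases hi : IntegrableOn (fun x => g x i * ψ x) W
      · have hni2 : ¬ IntegrableOn (fun x => g x i * (ψ x + φ x)) W := by
          intro hc
          apply hni
          refine (hc.sub hi).congr (Eventually.of_forall fun x => ?_)
          simp only [Pi.sub_apply]
          ring
        have h2 := hg (fun x => ψ x + φ x) (hψ.add hφ) (hψc.add hφc)
          ((tsupport_add ψ φ).trans (union_subset hψW hφW)) i
        rw [integral_undef hni2, neg_zero] at h2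
        have hIntg : ∀ η : Eu n → ℝ, ContDiff ℝ 1 η → HasCompactSupport η →
            IntegrableOn (fun x => u x * fderiv ℝ η x (EuclideanSpace.single i 1)) W := by
          intro η hη hηc
          have hc : Continuous (fun x => fderiv ℝ η x (EuclideanSpace.single i 1)) := by
            have := hη.continuous_fderiv (by simp)
            fun_prop
          obtain ⟨B, -, hB⟩ := bounded_of_hcs hc (hηc.fderiv_apply ℝ _)
          exact hu.mul_bdd (c := B) hc.aestronglyMeasurable (Eventually.of_forall hB)
        have e : ∀ x, u x * fderiv ℝ (fun x => ψ x + φ x) x (EuclideanSpace.single i 1) =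
            u x * fderiv ℝ ψ x (EuclideanSpace.single i 1) +
            u x * fderiv ℝ φ x (EuclideanSpace.single i 1) := by
          intro x
          rw [fderiv_fun_add (hψ.differentiable (by simp)).differentiableAt
            (hφ.differentiable (by simp)).differentiableAt]
          simp [mul_add]
        simp_rw [e] at h2
        rw [integral_add (hIntg ψ hψ hψc) (hIntg φ hφ hφc), h1, add_zero] at h2
        exact h2
      · have h2 := hg ψ hψ hψc hψW i
        rwa [integral_undef hi, neg_zero] at h2
  · intro x
    rw [EuclideanSpace.norm_eq, EuclideanSpace.norm_eq]
    apply Real.sqrt_le_sqrt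
    refine Finset.sum_le_sum fun i _ => ?_
    by_cases hP : P i
    · simp [G, hP]
    · simp [G, hP]
      positivity
  · have hi : ∀ i, AEMeasurable (fun x => if P i then g x i else 0) (volume.restrict W) := by
      intro i
      by_cases hP : P i
      · simp only [hP, if_true]
        apply AEStronglyMeasurable.aemeasurable
        apply LocallyIntegrableOn.aestronglyMeasurable
        rw [locallyIntegrableOn_iff hW.isLocallyClosed]
        intro K hKW hK
        obtain ⟨χ, hχ, hχc, hχW, -, hχ1⟩ := exists_cutoff hK hW hKW
        have := (hP χ hχ hχc hχW).mono_set hKW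
        refine this.congr_fun (fun x hx => ?_) hK.measurableSet
        simp [hχ1 x hx]
      · simp [hP]
    have := aemeasurable_pi_lambda _ hi
    exact (PiLp.continuous_toLp 2 (fun _ : Fin n => ℝ)).measurable.comp_aemeasurable this


lemma Mo_nonneg {n : ℕ} {κ : Eu n → ℝ} {δ : ℝ} (hκ : IsKer κ δ) {h : Eu n → ℝ} (hh : ∀ x, 0 ≤ h x)
    (x : Eu n) : 0 ≤ Mo κ h x :=
  integral_nonneg fun y => mul_nonneg (hκ.nonneg _) (hh y)

lemma MoE_ofReal {n : ℕ} {κ : Eu n → ℝ} {δ : ℝ} (hκ : IsKer κ δ) {h : Eu n → ℝ}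
    (hh : Integrable h) (h0 : ∀ x, 0 ≤ h x) (x : Eu n) :
    ENNReal.ofReal (Mo κ h x) = MoE κ (fun y => ENNReal.ofReal (h y)) x := by
  unfold Mo MoE
  rw [ofReal_integral_eq_lintegral_ofReal (Mo_integrand_integrable hκ hh x)
    (Eventually.of_forall fun y => mul_nonneg (hκ.nonneg _) (h0 y))]
  congr 1; ext y
  rw [ENNReal.ofReal_mul (hκ.nonneg _)]

lemma jensen {n : ℕ} {κ : Eu n → ℝ} {δ : ℝ} (hκ : IsKer κ δ) {H : Eu n → ℝ≥0∞}
    (hH : AEMeasurable H) {s : ℝ} (hs : 1 ≤ s) (x : Eu n) :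
    (MoE κ H x) ^ s ≤ MoE κ (fun y => H y ^ s) x := by
  rcases hs.eq_or_lt with rfl | hs
  · simp
  have hm : Measurable (fun y => ENNReal.ofReal (κ (x - y))) :=
    (hκ.smooth.continuous.comp (by fun_prop)).measurable.ennreal_ofReal
  set ν : Measure (Eu n) := volume.withDensity (fun y => ENNReal.ofReal (κ (x - y))) with hν
  have hac : ν ≪ volume := withDensity_absolutelyContinuous _ _
  have e : ∀ H : Eu n → ℝ≥0∞, AEMeasurable H → MoE κ H x = ∫⁻ y, H y ∂ν := by
    intro H hH
    rw [hν, lintegral_withDensity_eq_lintegral_mul₀ hm.aemeasurable hH]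
    rfl
  have hν1 : ν univ = 1 := by
    rw [hν, withDensity_apply _ MeasurableSet.univ, setLIntegral_univ, ker_lint_sub hκ]
  rw [e H hH, e _ (hH.pow_const s)]
  have hc := Real.HolderConjugate.conjExponent hs
  have := ENNReal.lintegral_mul_le_Lp_mul_Lq ν hc (hH.mono_ac hac)
    (aemeasurable_const (b := (1 : ℝ≥0∞)))
  simp only [Pi.mul_apply, mul_one, ENNReal.one_rpow, lintegral_const, hν1] at this
  calc _ ≤ ((∫⁻ a, H a ^ s ∂ν) ^ (1 / s)) ^ s := by gcongr
    _ = _ := by rw [← ENNReal.rpow_mul, one_div_mul_cancel (by linarith), ENNReal.rpow_one]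

lemma sob {n : ℕ} {κ : Eu n → ℝ} {δ : ℝ} (hκ : IsKer κ δ) {h u : Eu n → ℝ} (hh : Integrable h)
    {W : Set (Eu n)} (hW : IsOpen W) (hu : ∀ x ∈ W, h x = u x) {G : Eu n → Eu n}
    (hG : IsWeakGrad W u G) (hGi : IntegrableOn G W) {x : Eu n}
    (hx : Metric.closedBall x δ ⊆ W) :
    ‖fderiv ℝ (Mo κ h) x‖ ≤ Mo κ (W.indicator fun y => ‖G y‖) x := by
  have hNi : Integrable (W.indicator fun y => ‖G y‖) :=
    (integrable_indicator_iff hW.measurableSet).2 hGi.norm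
  have hN0 : ∀ y, 0 ≤ (W.indicator fun y => ‖G y‖) y := fun y => indicator_nonneg (by simp) y
  refine ContinuousLinearMap.opNorm_le_bound _ (Mo_nonneg hκ hN0 x) fun z => ?_
  rw [(Mo_hasFDerivAt hκ hh x).fderiv]
  have hfc : Continuous (fderiv ℝ κ) := hκ.smooth.continuous_fderiv (by simp)
  have hIntg : Integrable (fun y => h y • fderiv ℝ κ (x - y)) := by
    obtain ⟨B, -, hB⟩ := bounded_of_hcs hfc (hκ.hcs.fderiv ℝ)
    refine (hh.norm.mul_const B).mono' (hh.aestronglyMeasurable.smul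
      (hfc.comp (continuous_const.sub continuous_id)).aestronglyMeasurable)
      (Eventually.of_forall fun y => ?_)
    rw [norm_smul]
    exact mul_le_mul_of_nonneg_left (hB _) (norm_nonneg _)
  rw [ContinuousLinearMap.integral_apply hIntg]
  set ψ : Eu n → ℝ := fun y => κ (x - y) with hψ
  have hψ1 : ContDiff ℝ 1 ψ :=
    (hκ.smooth.of_le (by simp)).comp (contDiff_const.sub contDiff_id)
  have hts : tsupport ψ ⊆ Metric.closedBall x δ := by
    refine closure_minimal ?_ Metric.isClosed_closedBall
    intro y hy
    by_contra hcon
    apply hy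
    apply hκ.supp
    rw [Metric.mem_closedBall, dist_comm, dist_eq_norm] at hcon
    linarith
  have hψc : HasCompactSupport ψ :=
    (isCompact_closedBall x δ).of_isClosed_subset (isClosed_tsupport _) hts
  have hfd : ∀ y, fderiv ℝ ψ y = - fderiv ℝ κ (x - y) := by
    intro y
    have h1 : HasFDerivAt (fun y : Eu n => x - y) (-(ContinuousLinearMap.id ℝ (Eu n))) y := by
      simpa using (hasFDerivAt_id y).const_sub x
    have h2 := ((hκ.smooth.differentiable (by simp)) (x - y)).hasFDerivAt.comp y h1
    have := h2.fderiv
    rw [show ψ = κ ∘ (fun y => x - y) from rfl, this]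
    ext; simp
  have e1 : (∫ y, (h y • fderiv ℝ κ (x - y)) z) =
      ∑ i, z i * ∫ y in W, G y i * ψ y := by
    have : ∀ y, (h y • fderiv ℝ κ (x - y)) z =
        ∑ i, z i * (-(h y * fderiv ℝ ψ y (EuclideanSpace.single i 1))) := by
      intro y
      rw [hfd]
      simp only [_root_.smul_apply, smul_eq_mul]
      rw [clm_eq_sum (fderiv ℝ κ (x - y)) z, Finset.mul_sum]
      refine Finset.sum_congr rfl fun i _ => ?_
      simp only [_root_.neg_apply]
      ring
    simp_rw [this]
    rw [integral_finsetSum]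
    · refine Finset.sum_congr rfl fun i _ => ?_
      rw [integral_const_mul, integral_neg]
      congr 1
      have h3 := hG ψ hψ1 hψc (hts.trans hx) i
      rw [neg_eq_iff_eq_neg, ← h3, ← setIntegral_eq_integral_of_forall_compl_eq_zero (s := W)]
      · exact setIntegral_congr_fun hW.measurableSet fun y hy => by simp only [hu y hy]
      · intro y hy
        have : fderiv ℝ ψ y = 0 := by
          have : y ∉ tsupport (fderiv ℝ ψ) := fun hc => hy (hx (hts (tsupport_fderiv_subset ℝ hc)))
          exact image_eq_zero_of_notMem_tsupport this
        simp [this]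
    · intro i _
      refine Integrable.const_mul (Integrable.neg ?_) _
      have hc : Continuous fun y => fderiv ℝ ψ y (EuclideanSpace.single i 1) :=
        (hψ1.continuous_fderiv (by simp)).clm_apply continuous_const
      obtain ⟨B, -, hB⟩ := bounded_of_hcs hc (hψc.fderiv_apply ℝ _)
      exact hh.mul_bdd (c := B) hc.aestronglyMeasurable (Eventually.of_forall hB)
  obtain ⟨B, -, hB⟩ := bounded_of_hcs hψ1.continuous hψc
  have hGψ : ∀ i, IntegrableOn (fun y => G y i * ψ y) W := fun i => by
    have : IntegrableOn (fun y => G y i) W :=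
      (EuclideanSpace.proj (𝕜 := ℝ) i : Eu n →L[ℝ] ℝ).integrable_comp hGi
    exact this.mul_bdd (c := B) hψ1.continuous.aestronglyMeasurable (Eventually.of_forall hB)
  rw [e1]
  have e2 : ∑ i, z i * ∫ y in W, G y i * ψ y = ∫ y in W, ψ y * inner ℝ (G y) z := by
    simp_rw [← integral_const_mul]
    rw [← integral_finsetSum _ fun i _ => (hGψ i).const_mul _]
    congr 1; ext y
    simp only [PiLp.inner_apply, Finset.mul_sum]
    refine Finset.sum_congr rfl fun i _ => ?_
    simp; ring
  rw [e2]
  have e3 : Mo κ (W.indicator fun y => ‖G y‖) x = ∫ y in W, ψ y * ‖G y‖ := by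
    unfold Mo
    rw [← integral_indicator hW.measurableSet]
    congr 1; ext y
    by_cases hy : y ∈ W <;> simp [hy, hψ]
  rw [e3, ← integral_mul_const]
  refine norm_integral_le_of_norm_le ?_ (Eventually.of_forall fun y => ?_)
  · refine Integrable.mul_const ?_ _
    have := hGi.norm.mul_bdd (c := B) hψ1.continuous.aestronglyMeasurable (Eventually.of_forall hB)
    exact this.congr (Eventually.of_forall fun y => mul_comm _ _)
  · rw [norm_mul, Real.norm_of_nonneg (hκ.nonneg _), mul_assoc]
    exact mul_le_mul_of_nonneg_left (norm_inner_le_norm _ _) (hκ.nonneg _)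

lemma X_pt {n : ℕ} {κ : Eu n → ℝ} {δ : ℝ} (hκ : IsKer κ δ) {W : Set (Eu n)}
    {p N hR : Eu n → ℝ} (hN : Integrable N) (hN0 : ∀ x, 0 ≤ N x) (hRi : Integrable hR)
    (hR0 : ∀ x, 0 ≤ hR x) (hNR : ∀ x ∈ W, 1 + N x ^ p x ≤ hR x) (hp : ∀ x ∈ W, 1 ≤ p x)
    {x : Eu n} (hxW : x ∈ W) (hx : Metric.closedBall x δ ⊆ W) {q A : ℝ} (hq : 0 ≤ q) (hA : 1 ≤ A)
    (hpq : ∀ y ∈ Metric.closedBall x δ, |p x - p y| ≤ q) (hNA : Mo κ N x ≤ A) :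
    (Mo κ N x) ^ p x ≤ A ^ q * Mo κ hR x := by
  set t := Mo κ N x with ht
  have ht0 : 0 ≤ t := Mo_nonneg hκ hN0 x
  set s := max 1 (p x - q) with hs
  have hs1 : 1 ≤ s := le_max_left _ _
  have hsp : s ≤ p x := max_le (hp x hxW) (by linarith)
  have hps : p x ≤ s + q := by have := le_max_right 1 (p x - q); linarith
  have hAq : 1 ≤ A ^ q := Real.one_le_rpow hA hq
  have hts0 : 0 ≤ t ^ s := Real.rpow_nonneg ht0 s
  have h1 : t ^ p x ≤ A ^ q * t ^ s := by
    by_cases h : t ≤ 1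
    · have : t ^ p x ≤ t ^ s := by
        rcases ht0.eq_or_lt with h0 | h0
        · rw [← h0, Real.zero_rpow (by linarith), Real.zero_rpow (by linarith)]
        · exact Real.rpow_le_rpow_of_exponent_ge h0 h hsp
      nlinarith
    · push Not at h
      calc t ^ p x ≤ t ^ (s + q) := Real.rpow_le_rpow_of_exponent_le h.le hps
        _ = t ^ s * t ^ q := Real.rpow_add (by linarith) _ _
        _ ≤ t ^ s * A ^ q := by gcongr
        _ = _ := mul_comm _ _
  have h2 : t ^ s ≤ Mo κ hR x := by
    rw [← ENNReal.ofReal_le_ofReal_iff (Mo_nonneg hκ hR0 x), MoE_ofReal hκ hRi hR0,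
      ← ENNReal.ofReal_rpow_of_nonneg ht0 (by linarith), ht, MoE_ofReal hκ hN hN0]
    refine (jensen hκ hN.aestronglyMeasurable.aemeasurable.ennreal_ofReal hs1 x).trans ?_
    refine lintegral_mono fun y => ?_
    by_cases hy : κ (x - y) = 0
    · simp [hy]
    have hyb : y ∈ Metric.closedBall x δ := by
      by_contra hcon
      apply hy
      apply hκ.supp
      rw [Metric.mem_closedBall, dist_comm, dist_eq_norm] at hcon
      linarith
    refine mul_le_mul_right ?_ _
    simp only
    rw [ENNReal.ofReal_rpow_of_nonneg (hN0 y) (by linarith)]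
    apply ENNReal.ofReal_le_ofReal
    refine le_trans ?_ (hNR y (hx hyb))
    have hsy : s ≤ p y := max_le (hp y (hx hyb)) (by
      have := (abs_le.1 (hpq y hyb)).2; linarith)
    by_cases h : N y ≤ 1
    · have h3 := Real.rpow_le_one (hN0 y) h (z := s) (by linarith)
      have h4 := Real.rpow_nonneg (hN0 y) (p y)
      linarith
    · push Not at h
      have := Real.rpow_le_rpow_of_exponent_le h.le hsy
      linarith
  exact h1.trans (by gcongr)

lemma q_tendsto (c : ℝ) :
    Tendsto (fun δ : ℝ => c / Real.log (Real.exp 1 + 1 / (2 * δ))) (𝓝[>] 0) (𝓝 0) := by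
  refine Tendsto.const_div_atTop (Real.tendsto_log_atTop.comp ?_) c
  refine tendsto_atTop_add_const_left _ _ ?_
  simp_rw [one_div, mul_inv]
  exact Tendsto.const_mul_atTop (by norm_num) tendsto_inv_nhdsGT_zero

lemma lemE {c K₀ : ℝ} (hc : 0 < c) (hK : 1 ≤ K₀) (m : ℕ) :
    ∀ᶠ δ : ℝ in 𝓝[>] 0, (K₀ * (δ ^ m)⁻¹) ^ (c / Real.log (Real.exp 1 + 1 / (2 * δ))) ≤
      2 * Real.exp (m * c) := by
  have hq := q_tendsto c
  have hq2 := hq.mul_const (Real.log K₀ + m * Real.log 2)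
  rw [zero_mul] at hq2
  have h2 := hq2.eventually (gt_mem_nhds (Real.log_pos one_lt_two))
  filter_upwards [h2, self_mem_nhdsWithin] with δ h2 hδ
  have hδ : 0 < δ := hδ
  set L := Real.log (Real.exp 1 + 1 / (2 * δ)) with hL
  have hL1 : 1 ≤ L := by
    rw [hL, Real.le_log_iff_exp_le (by positivity)]
    have : 0 < 1 / (2 * δ) := by positivity
    linarith
  have hpos : 0 < K₀ * (δ ^ m)⁻¹ := by positivity
  rw [Real.rpow_def_of_pos hpos]
  have hlog : Real.log (K₀ * (δ ^ m)⁻¹) = Real.log K₀ + m * -Real.log δ := by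
    rw [Real.log_mul (by positivity) (by positivity), Real.log_inv, Real.log_pow]; ring
  have hld : -Real.log δ ≤ L + Real.log 2 := by
    have h3 : Real.log (1 / (2 * δ)) ≤ L := Real.log_le_log (by positivity) (by
      have := Real.exp_pos 1; linarith)
    rw [one_div, Real.log_inv, Real.log_mul (by norm_num) hδ.ne'] at h3
    linarith
  have hcL : c / L * L = c := by field_simp
  have hcL0 : 0 ≤ c / L := by positivity
  have : Real.log (K₀ * (δ ^ m)⁻¹) * (c / L) ≤ Real.log 2 + m * c := by
    rw [hlog]
    have : (m : ℝ) * -Real.log δ ≤ m * (L + Real.log 2) := by gcongr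
    calc (Real.log K₀ + m * -Real.log δ) * (c / L) ≤
        (Real.log K₀ + m * (L + Real.log 2)) * (c / L) := by gcongr
      _ = c / L * (Real.log K₀ + m * Real.log 2) + m * (c / L * L) := by ring
      _ ≤ _ := by rw [hcL]; linarith
  calc _ ≤ Real.exp (Real.log 2 + m * c) := Real.exp_le_exp.2 this
    _ = _ := by rw [Real.exp_add, Real.exp_log (by norm_num)]

lemma X_dct {n : ℕ} {φ : Eu n → ℝ} (hφ : IsKer φ 1) {S : Set (Eu n)} (hS : MeasurableSet S)
    {p N hR : Eu n → ℝ} (hN : Integrable N) (hRi : Integrable hR)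
    (hN0 : ∀ x, 0 ≤ N x) 
    (hR0 : ∀ x, 0 ≤ hR x) (hpm : Measurable p) (hp : ∀ x ∈ S, 1 ≤ p x) {Kc : ℝ} (hK : 0 ≤ Kc)
    {ε : ℝ≥0∞} (hε : 0 < ε) (hfin : ∫⁻ x in S, ENNReal.ofReal (N x ^ p x) ≠ ⊤) :
    ∀ᶠ δ : ℝ in 𝓝[>] 0, ∫⁻ x in S, ENNReal.ofReal
      (min ((Mo (scaleKer φ δ) N x) ^ p x) (Kc * Mo (scaleKer φ δ) hR x)) ≤
      (∫⁻ x in S, ENNReal.ofReal (N x ^ p x)) + ε := by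
  have hRm : AEMeasurable hR := hRi.aestronglyMeasurable.aemeasurable
  have hMm : ∀ δ > 0, Measurable (Mo (scaleKer φ δ) N) := fun δ hδ =>
    (Mo_contDiff (scaleKer_isKer hφ hδ) hN).continuous.measurable
  have T1 : Tendsto (fun δ : ℝ => ∫⁻ x in S, ENNReal.ofReal
      (min ((Mo (scaleKer φ δ) N x) ^ p x) (Kc * hR x))) (𝓝[>] 0)
      (𝓝 (∫⁻ x in S, ENNReal.ofReal (min (N x ^ p x) (Kc * hR x)))) := by
    refine tendsto_of_subseq_tendsto fun d hd => ?_
    have hL1 := (Mo_L1 hφ hN).comp hd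
    have hd0 : ∀ᶠ k in atTop, 0 < d k := hd.eventually self_mem_nhdsWithin
    have hmeas : TendstoInMeasure volume (fun k => if 0 < d k then Mo (scaleKer φ (d k)) N else 0)
        atTop N := by
      refine tendstoInMeasure_of_tendsto_eLpNorm one_ne_zero (fun k => ?_)
        hN.aestronglyMeasurable ?_
      · split_ifs with h
        · exact (hMm _ h).aestronglyMeasurable
        · exact aestronglyMeasurable_zero
      · refine hL1.congr' ?_
        filter_upwards [hd0] with k hk
        simp [eLpNorm_one_eq_lintegral_enorm, hk]
    obtain ⟨ns, hns, hae⟩ := hmeas.exists_seq_tendsto_ae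
    refine ⟨ns, ?_⟩
    have hd0' : ∀ᶠ k in atTop, 0 < d (ns k) := hns.tendsto_atTop.eventually hd0
    have T0 : Tendsto (fun k => ∫⁻ x in S, ENNReal.ofReal
      (min ((if 0 < d (ns k) then Mo (scaleKer φ (d (ns k))) N else 0) x ^ p x) (Kc * hR x))) atTop
      (𝓝 (∫⁻ x in S, ENNReal.ofReal (min (N x ^ p x) (Kc * hR x)))) := ?_
    · refine T0.congr' ?_
      filter_upwards [hd0'] with k hk
      simp [hk]
    refine tendsto_lintegral_of_dominated_convergence'
      (fun x => ENNReal.ofReal (Kc * hR x)) ?_ ?_ ?_ ?_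
    · intro k
      have : Measurable (if 0 < d (ns k) then Mo (scaleKer φ (d (ns k))) N else 0) := by
        split_ifs with h
        · exact hMm _ h
        · exact measurable_zero
      exact ((this.pow hpm).aemeasurable.min (hRm.restrict.const_mul Kc)).ennreal_ofReal
    · intro k
      exact Eventually.of_forall fun x => ENNReal.ofReal_le_ofReal (min_le_right _ _)
    · have := ((hRi.const_mul Kc).integrableOn (s := S)).lintegral_lt_top
      exact this.ne
    · filter_upwards [ae_restrict_of_ae hae, ae_restrict_mem hS] with x hx hxS
      refine ENNReal.tendsto_ofReal (Tendsto.min ?_ tendsto_const_nhds)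
      exact hx.rpow_const (Or.inr (by have := hp x hxS; linarith))
  have T2 := ENNReal.Tendsto.const_mul (Mo_L1 hφ hRi) (a := ENNReal.ofReal Kc)
    (Or.inr ENNReal.ofReal_ne_top)
  have T3 := T1.add T2
  rw [mul_zero, add_zero] at T3
  have hle : ∫⁻ x in S, ENNReal.ofReal (min (N x ^ p x) (Kc * hR x)) ≤
      ∫⁻ x in S, ENNReal.ofReal (N x ^ p x) :=
    lintegral_mono fun x => ENNReal.ofReal_le_ofReal (min_le_left _ _)
  have hlt : ∫⁻ x in S, ENNReal.ofReal (min (N x ^ p x) (Kc * hR x)) <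
      (∫⁻ x in S, ENNReal.ofReal (N x ^ p x)) + ε :=
    hle.trans_lt (ENNReal.lt_add_right hfin hε.ne')
  filter_upwards [T3.eventually (gt_mem_nhds hlt), self_mem_nhdsWithin] with δ h hδ
  refine le_trans ?_ h.le
  have hδ : 0 < δ := hδ
  have hκ := scaleKer_isKer hφ hδ
  have hRc : Measurable (Mo (scaleKer φ δ) hR) := (Mo_contDiff hκ hRi).continuous.measurable
  calc _ ≤ ∫⁻ x in S, (ENNReal.ofReal (min ((Mo (scaleKer φ δ) N x) ^ p x) (Kc * hR x)) +
        ENNReal.ofReal Kc * ‖Mo (scaleKer φ δ) hR x - hR x‖ₑ) := by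
        refine lintegral_mono fun x => ?_
        simp only
        rw [← ofReal_norm, ← ENNReal.ofReal_mul hK, ← ENNReal.ofReal_add
          (le_min (Real.rpow_nonneg (Mo_nonneg hκ hN0 x) _) (mul_nonneg hK (hR0 x)))
          (by positivity)]
        apply ENNReal.ofReal_le_ofReal
        have h1 : Kc * Mo (scaleKer φ δ) hR x ≤ Kc * hR x +
            Kc * ‖Mo (scaleKer φ δ) hR x - hR x‖ := by
          rw [← mul_add]
          refine mul_le_mul_of_nonneg_left ?_ hK
          have := Real.le_norm_self (Mo (scaleKer φ δ) hR x - hR x)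
          linarith
        have h2 : 0 ≤ Kc * ‖Mo (scaleKer φ δ) hR x - hR x‖ := by positivity
        rcases min_cases (Mo (scaleKer φ δ) N x ^ p x) (Kc * hR x) with ⟨e, _⟩ | ⟨e, _⟩ <;> rw [e]
        · exact (min_le_left _ _).trans (by linarith)
        · exact (min_le_right _ _).trans h1
    _ = (∫⁻ x in S, ENNReal.ofReal (min ((Mo (scaleKer φ δ) N x) ^ p x) (Kc * hR x))) +
        ENNReal.ofReal Kc * ∫⁻ x in S, ‖Mo (scaleKer φ δ) hR x - hR x‖ₑ := by
        rw [lintegral_add_left', lintegral_const_mul'']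
        · exact ((hRc.aemeasurable.sub hRm).enorm).restrict
        · exact (((hMm _ hδ).pow hpm).aemeasurable.min (hRm.restrict.const_mul Kc)).ennreal_ofReal
    _ ≤ _ := by
        gcongr
        exact Measure.restrict_le_self


lemma N_pt {α β γ A B r q : ℝ} (hγ : 0 ≤ γ) (hβ : 0 ≤ β) (hs : γ ≤ α + β) (hαA : α ≤ A) (hA : 1 ≤ A)
    (hβB : β ≤ B) (hB : 1 ≤ B) (hr : 0 ≤ r) (hrq : r ≤ q) :
    γ ^ (1 + r) ≤ (2 * A) ^ q * γ + 2 * (2 * B) ^ q * β := by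
  have e : γ ^ (1 + r) = γ * γ ^ r := by
    rw [Real.rpow_add_of_nonneg hγ (by norm_num) hr, Real.rpow_one]
  have hAq : 0 ≤ (2 * A) ^ q := by positivity
  have hBq : 0 ≤ (2 * B) ^ q := by positivity
  rw [e]
  by_cases h : β ≤ A
  · have h1 : γ ^ r ≤ (2 * A) ^ q := (Real.rpow_le_rpow hγ (by linarith) hr).trans
      (Real.rpow_le_rpow_of_exponent_le (by linarith) hrq)
    have : γ * γ ^ r ≤ γ * (2 * A) ^ q := by gcongr
    have : 0 ≤ 2 * (2 * B) ^ q * β := by positivity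
    linarith
  · push Not at h
    have h1 : γ ^ r ≤ (2 * B) ^ q := (Real.rpow_le_rpow hγ (by linarith) hr).trans
      (Real.rpow_le_rpow_of_exponent_le (by linarith) hrq)
    have : γ * γ ^ r ≤ (2 * β) * (2 * B) ^ q := by gcongr; linarith
    have : 0 ≤ (2 * A) ^ q * γ := by positivity
    linarith

lemma N_part {n : ℕ} {φ : Eu n → ℝ} (hφ : IsKer φ 1) {U V K : Set (Eu n)} (hU : IsOpen U)
    (hV : IsOpen V) (hK : IsCompact K) (hKV : K ⊆ V) {δ₀ : ℝ} (hδ₀ : 0 < δ₀)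
    (hVU : ∀ x ∈ V, Metric.closedBall x δ₀ ⊆ U) {h p : Eu n → ℝ} (hh : Integrable h)
    (hT : totVarOpen U h ≠ ⊤) {c : ℝ} (hc : 0 < c) {ε : ℝ} (hε : 0 < ε) :
    ∀ᶠ δ : ℝ in 𝓝[>] 0, ∀ S : Set (Eu n), MeasurableSet S → S ⊆ K →
      (∀ x ∈ S, 1 ≤ p x ∧ p x - 1 ≤ c / Real.log (Real.exp 1 + 1 / (2 * δ))) →
      ∫⁻ x in S, ENNReal.ofReal (‖fderiv ℝ (Mo (scaleKer φ δ) h) x‖ ^ p x) ≤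
        ENNReal.ofReal (2 * Real.exp c) * totVarOpen U h + ENNReal.ofReal ε := by
  set η := ε / (4 * Real.exp ((n + 1 : ℕ) * c)) with hη
  have hη0 : 0 < η := by positivity
  obtain ⟨k, hk, hkb⟩ := trunc hφ hU hh hT hη0
  set a : Eu n → ℝ := fun x => ar k (h x) with ha
  set b : Eu n → ℝ := fun x => h x - ar k (h x) with hb
  have hai : Integrable a := lip_comp_integrable hh (ar_lip hk) (ar_zero k)
  have hbi : Integrable b := hh.sub hai
  obtain ⟨B, hB1, hB2, hB3⟩ := scaleKer_fderiv_bound hφ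
  have hI : 0 ≤ ∫ y, |b y| := integral_nonneg fun y => abs_nonneg _
  have E1 := lemE hc (K₀ := 2 * (1 + k * 2 * B)) (by nlinarith [mul_pos hk (by linarith : 0 < B)]) 1
  have E2 := lemE hc (K₀ := 2 * (1 + (∫ y, |b y|) * B)) (by nlinarith) (n + 1)
  filter_upwards [E1, E2, self_mem_nhdsWithin, nhdsWithin_le_nhds (gt_mem_nhds hδ₀),
    nhdsWithin_le_nhds (gt_mem_nhds one_pos)] with δ E1 E2 hδ hδδ hδ1 S hS hSK hSp
  have hδ : 0 < δ := hδ
  have hκ := scaleKer_isKer hφ hδ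
  set q := c / Real.log (Real.exp 1 + 1 / (2 * δ)) with hq
  set κ := scaleKer φ δ with hκd
  have hi1 : 1 ≤ δ⁻¹ := (one_le_inv₀ hδ).2 hδ1.le
  have hi2 : 1 ≤ (δ ^ (n + 1))⁻¹ := (one_le_inv₀ (by positivity)).2 (pow_le_one₀ hδ.le hδ1.le)
  have hVU' : ∀ x ∈ V, Metric.closedBall x δ ⊆ U := fun x hx =>
    (Metric.closedBall_subset_closedBall hδδ.le).trans (hVU x hx)
  have hMh := Mo_contDiff hκ hh
  have hMa := Mo_contDiff hκ hai
  have hMb := Mo_contDiff hκ hbi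
  have hpt : ∀ x ∈ S, ENNReal.ofReal (‖fderiv ℝ (Mo κ h) x‖ ^ p x) ≤
      ENNReal.ofReal (2 * Real.exp c) * ‖fderiv ℝ (Mo κ h) x‖ₑ +
      ENNReal.ofReal (4 * Real.exp ((n + 1 : ℕ) * c)) * ‖fderiv ℝ (Mo κ b) x‖ₑ := by
    intro x hx
    rw [← ofReal_norm, ← ofReal_norm, ← ENNReal.ofReal_mul (by positivity),
      ← ENNReal.ofReal_mul (by positivity), ← ENNReal.ofReal_add (by positivity) (by positivity)]
    apply ENNReal.ofReal_le_ofReal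
    have hab : Mo κ h = fun x => Mo κ a x + Mo κ b x := by
      ext z
      rw [← Mo_add hκ hai hbi]
      congr 1
      ext y
      simp [ha, hb]
    have hfd : ‖fderiv ℝ (Mo κ h) x‖ ≤ ‖fderiv ℝ (Mo κ a) x‖ + ‖fderiv ℝ (Mo κ b) x‖ := by
      rw [hab, fderiv_fun_add (hMa.differentiable (by simp)).differentiableAt
        (hMb.differentiable (by simp)).differentiableAt]
      exact norm_add_le _ _
    have hα : ‖fderiv ℝ (Mo κ a) x‖ ≤ (1 + k * 2 * B) * δ⁻¹ := by
      refine (norm_fderiv_Mo_le_bdd hκ hai (fun z => ar_bdd hk _) x).trans ?_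
      calc _ ≤ k * 2 * (B * δ⁻¹) := by gcongr; exact hB3 δ hδ
        _ ≤ _ := by nlinarith
    have hβ : ‖fderiv ℝ (Mo κ b) x‖ ≤ (1 + (∫ y, |b y|) * B) * (δ ^ (n + 1))⁻¹ := by
      refine (norm_fderiv_Mo_le_sup hκ hbi (hB2 δ hδ) x).trans ?_
      nlinarith
    have h1 := N_pt (norm_nonneg _) (norm_nonneg _) hfd hα
      (by nlinarith [mul_pos hk (by linarith : 0 < B)]) hβ (one_le_mul_of_one_le_of_one_le (by nlinarith) hi2) (r := p x - 1) (q := q)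
      (by linarith [(hSp x hx).1]) (hSp x hx).2
    rw [add_sub_cancel] at h1
    refine h1.trans ?_
    rw [pow_one, mul_assoc] at E1
    rw [mul_assoc] at E2
    have E1' : (2 * ((1 + k * 2 * B) * δ⁻¹)) ^ q ≤ 2 * Real.exp c := by simpa using E1
    have : 2 * (2 * ((1 + (∫ y, |b y|) * B) * (δ ^ (n + 1))⁻¹)) ^ q ≤
        4 * Real.exp ((n + 1 : ℕ) * c) := by linarith
    gcongr
  have hm : ∀ v : Eu n → ℝ, ContDiff ℝ (⊤ : ℕ∞) v → Measurable fun x => ‖fderiv ℝ v x‖ₑ :=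
    fun v hv => (hv.continuous_fderiv (by simp)).measurable.enorm
  have hin : ∀ v : Eu n → ℝ, Integrable v → ∫⁻ x in S, ‖fderiv ℝ (Mo κ v) x‖ₑ ≤ totVarOpen U v :=
    fun v hv => (lintegral_mono_set hSK).trans
      ((grad_le_tv (Mo_contDiff hκ hv) hK hV hKV).trans (Mo_tv_le hκ hv hVU'))
  calc _ ≤ ∫⁻ x in S, (ENNReal.ofReal (2 * Real.exp c) * ‖fderiv ℝ (Mo κ h) x‖ₑ +
      ENNReal.ofReal (4 * Real.exp ((n + 1 : ℕ) * c)) * ‖fderiv ℝ (Mo κ b) x‖ₑ) :=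
        setLIntegral_mono' hS hpt
    _ = ENNReal.ofReal (2 * Real.exp c) * (∫⁻ x in S, ‖fderiv ℝ (Mo κ h) x‖ₑ) +
      ENNReal.ofReal (4 * Real.exp ((n + 1 : ℕ) * c)) * ∫⁻ x in S, ‖fderiv ℝ (Mo κ b) x‖ₑ := by
        rw [lintegral_add_left ((hm _ hMh).const_mul _), lintegral_const_mul _ (hm _ hMh),
          lintegral_const_mul _ (hm _ hMb)]
    _ ≤ ENNReal.ofReal (2 * Real.exp c) * totVarOpen U h +
      ENNReal.ofReal (4 * Real.exp ((n + 1 : ℕ) * c)) * ENNReal.ofReal η := by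
        gcongr
        · exact hin h hh
        · exact (hin b hbi).trans hkb
    _ = _ := by
        rw [← ENNReal.ofReal_mul (by positivity), hη, mul_div_cancel₀ _ (by positivity)]

lemma logq {n : ℕ} {c : ℝ} (hc : 0 < c) {Ω : Set (Eu n)} {p : Eu n → ℝ} (hp : LogHolderOn c Ω p)
    {x y : Eu n} (hx : x ∈ Ω) (hy : y ∈ Ω) {δ : ℝ} (hδ : 0 < δ) (hd : dist x y ≤ 2 * δ) :
    |p x - p y| ≤ c / Real.log (Real.exp 1 + 1 / (2 * δ)) := by
  have hL : ∀ t : ℝ, 0 ≤ t → 1 ≤ Real.log (Real.exp 1 + t) := fun t ht => by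
    rw [Real.le_log_iff_exp_le (by positivity)]; linarith
  rcases eq_or_ne x y with rfl | hne
  · have := hL (1 / (2 * δ)) (by positivity)
    rw [sub_self, abs_zero]; positivity
  · refine (hp x hx y hy).trans ?_
    have hd0 : 0 < dist x y := dist_pos.2 hne
    have := hL (1 / (2 * δ)) (by positivity)
    refine div_le_div_of_nonneg_left hc.le (by linarith) ?_
    exact Real.log_le_log (by positivity) (by gcongr)


lemma W_open {n : ℕ} {c : ℝ} (hc : 0 < c) {Ω : Set (Eu n)} (hΩ : IsOpen Ω) {p : Eu n → ℝ}
    (hp : LogHolderOn c Ω p) (hp1 : ∀ x ∈ Ω, 1 ≤ p x) : IsOpen (Ω \ {x | p x = 1}) := by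
  rw [Metric.isOpen_iff]
  rintro x ⟨hx, hx1⟩
  have h1 : 0 < p x - 1 := by
    have := lt_of_le_of_ne (hp1 x hx) (Ne.symm hx1)
    linarith
  obtain ⟨δ, hδq, hδ⟩ := (((q_tendsto c).eventually (gt_mem_nhds h1)).and self_mem_nhdsWithin).exists
  have hδ : 0 < δ := hδ
  obtain ⟨r, hr, hrΩ⟩ := Metric.isOpen_iff.1 hΩ x hx
  refine ⟨min r δ, lt_min hr hδ, fun y hy => ?_⟩
  rw [Metric.mem_ball, lt_min_iff, dist_comm] at hy
  have hyΩ : y ∈ Ω := hrΩ (by rw [Metric.mem_ball, dist_comm]; exact hy.1)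
  refine ⟨hyΩ, fun hy1 => ?_⟩
  have h2 := logq hc hp hx hyΩ hδ (by linarith [hy.2])
  have hy1 : p y = 1 := hy1
  rw [hy1] at h2
  have := le_abs_self (p x - 1)
  linarith

lemma le_one_add_rpow {t s : ℝ} (ht : 0 ≤ t) (hs : 1 ≤ s) : t ≤ 1 + t ^ s := by
  have := Real.rpow_nonneg ht s
  by_cases h : t ≤ 1
  · linarith
  · push Not at h
    have := Real.rpow_le_rpow_of_exponent_le h.le hs
    rw [Real.rpow_one] at this
    linarith

lemma u_int {n : ℕ} {Ω : Set (Eu n)} (hΩ : IsOpen Ω) (hb : Bornology.IsBounded Ω)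
    {p u : Eu n → ℝ} (hp1 : ∀ x ∈ Ω, 1 ≤ p x) (hu : MemLpVar p Ω u) : IntegrableOn u Ω := by
  obtain ⟨hm, l, hl, hv⟩ := hu
  refine ⟨hm.aestronglyMeasurable, ?_⟩
  have h1 : ∫⁻ x in Ω, ‖u x‖ₑ ≤ ∫⁻ x in Ω, ENNReal.ofReal l * (1 + ENNReal.ofReal (|u x / l| ^ p x)) := by
    refine setLIntegral_mono' hΩ.measurableSet fun x hx => ?_
    rw [← ofReal_norm, ← ENNReal.ofReal_one, ← ENNReal.ofReal_add zero_le_one (by positivity),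
      ← ENNReal.ofReal_mul hl.le]
    apply ENNReal.ofReal_le_ofReal
    have := le_one_add_rpow (abs_nonneg (u x / l)) (hp1 x hx)
    calc ‖u x‖ = l * |u x / l| := by
          rw [abs_div, abs_of_pos hl, Real.norm_eq_abs]; field_simp
      _ ≤ _ := by gcongr
  refine h1.trans_lt ?_
  rw [lintegral_const_mul' _ _ ENNReal.ofReal_ne_top, lintegral_add_left measurable_const]
  refine ENNReal.mul_lt_top ENNReal.ofReal_lt_top (ENNReal.add_lt_top.2 ⟨?_, hv⟩)
  simpa using hb.measure_lt_top

lemma mainE {n : ℕ} {c : ℝ} (hc : 0 < c) {Ω F : Set (Eu n)} {p u φ : Eu n → ℝ} {g : Eu n → Eu n}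
    (hΩ : IsOpen Ω) (hΩb : Bornology.IsBounded Ω) (hpm : Measurable p) (hp1 : ∀ x ∈ Ω, 1 ≤ p x)
    (hp : LogHolderOn c Ω p) (hu : MemLpVar p Ω u) (hg : IsWeakGrad (Ω \ {x | p x = 1}) u g)
    (hfin : hhlModular p Ω Ω u g < ⊤) (hF : IsClosed F) (hFΩ : F ⊆ Ω) (hφ : IsKer φ 1)
    (hT : totVarIn Ω (F ∩ {x | p x = 1}) u ≠ ⊤) {ε : ℝ} (hε : 0 < ε) :
    ∀ᶠ δ : ℝ in 𝓝[>] 0, hhlModularSmooth p Ω F (Mo (scaleKer φ δ) (Ω.indicator u)) ≤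
      (totVarIn Ω (F ∩ {x | p x = 1}) u + ENNReal.ofReal ε) +
      ((ENNReal.ofReal (2 * Real.exp c) * (totVarIn Ω (F ∩ {x | p x = 1}) u + ENNReal.ofReal ε) +
      ENNReal.ofReal ε) +
      ((∫⁻ x in F \ {x | p x = 1}, ENNReal.ofReal (‖g x‖ ^ p x)) + ENNReal.ofReal ε)) := by
  set Y : Set (Eu n) := {x | p x = 1} with hY
  have hYm : MeasurableSet Y := hpm (measurableSet_singleton 1)
  set W := Ω \ Y with hWd
  have hW : IsOpen W := W_open hc hΩ hp hp1
  have hFc : IsCompact F := Metric.isCompact_of_isClosed_isBounded hF (hΩb.subset hFΩ)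
  have hFW : F \ Y ⊆ W := diff_subset_diff_left hFΩ
  have hKc : IsCompact (F ∩ Y) := by
    have : F ∩ Y = F \ W := by
      ext x; constructor
      · rintro ⟨h1, h2⟩; exact ⟨h1, fun h => h.2 h2⟩
      · rintro ⟨h1, h2⟩; exact ⟨h1, by_contra fun h => h2 ⟨hFΩ h1, h⟩⟩
    rw [this]; exact hFc.diff hW
  have huI := u_int hΩ hΩb hp1 hu
  set h := Ω.indicator u with hh
  have hhi : Integrable h := (integrable_indicator_iff hΩ.measurableSet).2 huI
  have hhu : ∀ x ∈ Ω, h x = u x := fun x hx => by simp [hh, hx]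
  -- the gradient
  obtain ⟨G, hG, hGg, hGm⟩ := weakGrad_fix hW (huI.mono_set diff_subset) hg
  have hgfin : ∫⁻ x in W, ENNReal.ofReal (‖g x‖ ^ p x) < ⊤ :=
    lt_of_le_of_lt le_add_self hfin
  have hGp : ∀ x ∈ W, ENNReal.ofReal (‖G x‖ ^ p x) ≤ ENNReal.ofReal (‖g x‖ ^ p x) := fun x hx =>
    ENNReal.ofReal_le_ofReal (Real.rpow_le_rpow (norm_nonneg _) (hGg x)
      (by linarith [hp1 x hx.1]))
  have hGfin : ∫⁻ x in W, ENNReal.ofReal (‖G x‖ ^ p x) < ⊤ :=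
    (setLIntegral_mono' hW.measurableSet hGp).trans_lt hgfin
  have hWfin : volume W < ⊤ := (hΩb.subset diff_subset).measure_lt_top
  have hRi0 : IntegrableOn (fun x => 1 + ‖G x‖ ^ p x) W := by
    refine (integrableOn_const hWfin.ne).add ⟨?_, ?_⟩
    · exact (hGm.norm.pow hpm.aemeasurable).aestronglyMeasurable
    · refine lt_of_le_of_lt (lintegral_mono fun x => ?_) hGfin
      rw [Real.enorm_of_nonneg (by positivity)]
  have hGi : IntegrableOn G W := by
    refine hRi0.mono' hGm.aestronglyMeasurable ?_
    filter_upwards [ae_restrict_mem hW.measurableSet] with x hx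
    exact le_one_add_rpow (norm_nonneg _) (hp1 x hx.1)
  set N : Eu n → ℝ := W.indicator fun x => ‖G x‖ with hNd
  set hR : Eu n → ℝ := W.indicator fun x => 1 + ‖G x‖ ^ p x with hRd
  have hNi : Integrable N := (integrable_indicator_iff hW.measurableSet).2 hGi.norm
  have hRi : Integrable hR := (integrable_indicator_iff hW.measurableSet).2 hRi0
  have hN0 : ∀ x, 0 ≤ N x := fun x => indicator_nonneg (fun y _ => norm_nonneg _) x
  have hR0 : ∀ x, 0 ≤ hR x := fun x => indicator_nonneg (fun y _ => by positivity) x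
  have hNR : ∀ x ∈ W, 1 + N x ^ p x ≤ hR x := fun x hx => by simp [hNd, hRd, hx]
  have hNp : ∫⁻ x in F \ Y, ENNReal.ofReal (N x ^ p x) ≤
      ∫⁻ x in F \ Y, ENNReal.ofReal (‖g x‖ ^ p x) := by
    refine setLIntegral_mono' (hF.measurableSet.diff hYm) fun x hx => ?_
    have : N x = ‖G x‖ := by simp [hNd, hFW hx]
    rw [this]
    exact hGp x (hFW hx)
  have hNfin : ∫⁻ x in F \ Y, ENNReal.ofReal (N x ^ p x) ≠ ⊤ :=
    (hNp.trans_lt ((lintegral_mono_set hFW).trans_lt hgfin)).ne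
  -- the open set
  have hlt : totVarIn Ω (F ∩ Y) u < totVarIn Ω (F ∩ Y) u + ENNReal.ofReal ε :=
    ENNReal.lt_add_right hT (by simpa using hε)
  obtain ⟨U, ⟨hUo, hKU, hUΩ⟩, hUT⟩ : ∃ U : Set (Eu n), (IsOpen U ∧ F ∩ Y ⊆ U ∧ U ⊆ Ω) ∧
      totVarOpen U u < totVarIn Ω (F ∩ Y) u + ENNReal.ofReal ε := by
    conv at hlt => lhs; unfold totVarIn
    simpa only [iInf_lt_iff, exists_prop] using hlt
  have hTU : totVarOpen U h = totVarOpen U u :=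
    tv_congr hUo.measurableSet fun x hx => hhu x (hUΩ hx)
  have hTUf : totVarOpen U h ≠ ⊤ := by rw [hTU]; exact hUT.ne_top
  obtain ⟨r, hr, hrU⟩ := hKc.exists_cthickening_subset_open hUo hKU
  set V := Metric.thickening (r / 2) (F ∩ Y) with hVd
  set K' := Metric.cthickening (r / 4) (F ∩ Y) with hK'd
  have hVo : IsOpen V := Metric.isOpen_thickening
  have hK'c : IsCompact K' := hKc.cthickening
  have hK'V : K' ⊆ V := Metric.cthickening_subset_thickening' (by linarith) (by linarith) _
  have hVU : ∀ x ∈ V, Metric.closedBall x (r / 4) ⊆ U := by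
    intro x hx y hy
    obtain ⟨z, hz, hxz⟩ := Metric.mem_thickening_iff.1 hx
    refine hrU (Metric.thickening_subset_cthickening _ _ (Metric.mem_thickening_iff.2 ⟨z, hz, ?_⟩))
    have := dist_triangle y x z
    rw [Metric.mem_closedBall] at hy
    linarith
  have hVsU : V ⊆ U := fun x hx => hVU x hx (Metric.mem_closedBall_self (by linarith))
  have hKV : F ∩ Y ⊆ V := Metric.self_subset_thickening (by linarith) _
  obtain ⟨r₁, hr₁, hr₁Ω⟩ := hFc.exists_cthickening_subset_open hΩ hFΩ
  have hZc : IsCompact (F \ Metric.thickening (r / 4) (F ∩ Y)) := hFc.diff Metric.isOpen_thickening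
  have hZW : F \ Metric.thickening (r / 4) (F ∩ Y) ⊆ W := fun x hx =>
    ⟨hFΩ hx.1, fun hxY => hx.2 (Metric.self_subset_thickening (by linarith) _ ⟨hx.1, hxY⟩)⟩
  obtain ⟨s, hs, hsW⟩ := hZc.exists_cthickening_subset_open hW hZW
  obtain ⟨B, hB1, hB⟩ := scaleKer_le hφ
  have hNint : 0 ≤ ∫ y, N y := integral_nonneg hN0
  have EX := lemE hc (K₀ := 1 + B * ∫ y, N y) (by nlinarith) n
  have EN := N_part hφ hUo hVo hK'c hK'V (by linarith : 0 < r / 4) hVU hhi hTUf hc hε (p := p)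
  have ED := X_dct hφ (hF.measurableSet.diff hYm) hNi hRi hN0 hR0 hpm
    (fun x hx => hp1 x (hFΩ hx.1)) (Kc := 2 * Real.exp (n * c)) (by positivity)
    (ε := ENNReal.ofReal ε) (by simpa using hε) hNfin
  filter_upwards [EX, EN, ED, self_mem_nhdsWithin, nhdsWithin_le_nhds (gt_mem_nhds hr₁),
    nhdsWithin_le_nhds (gt_mem_nhds (by linarith : 0 < r / 4)),
    nhdsWithin_le_nhds (gt_mem_nhds (by linarith : 0 < s / 2)),
    nhdsWithin_le_nhds (gt_mem_nhds one_pos)]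
    with δ EX EN ED hδ hδr₁ hδr hδs hδ1
  have hδ : 0 < δ := hδ
  have hκ := scaleKer_isKer hφ hδ
  set κ := scaleKer φ δ with hκd
  set q := c / Real.log (Real.exp 1 + 1 / (2 * δ)) with hq
  have hq0 : 0 ≤ q := by
    have : 1 ≤ Real.log (Real.exp 1 + 1 / (2 * δ)) := by
      rw [Real.le_log_iff_exp_le (by positivity)]
      have : 0 < 1 / (2 * δ) := by positivity
      linarith
    positivity
  have hball : ∀ x ∈ F, Metric.closedBall x δ ⊆ Ω := fun x hx =>
    (Metric.closedBall_subset_cthickening hx δ).trans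
      ((Metric.cthickening_mono hδr₁.le _).trans hr₁Ω)
  have hVU' : ∀ x ∈ V, Metric.closedBall x δ ⊆ U := fun x hx =>
    (Metric.closedBall_subset_closedBall hδr.le).trans (hVU x hx)
  -- the decomposition
  set D : Set (Eu n) := {x | Metric.infEDist x (Ω ∩ Y) < ENNReal.ofReal (2 * δ)} with hD
  have hDm : MeasurableSet D := measurableSet_lt measurable_infEDist measurable_const
  have hFYm : MeasurableSet (F \ Y) := hF.measurableSet.diff hYm
  have hDy : ∀ x ∈ D, ∃ y ∈ Ω ∩ Y, dist x y < 2 * δ := by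
    intro x hx
    obtain ⟨y, hy, hxy⟩ := Metric.infEDist_lt_iff.1 hx
    refine ⟨y, hy, ?_⟩
    rw [edist_dist] at hxy
    exact (ENNReal.ofReal_lt_ofReal_iff (by positivity)).1 hxy
  have hDN : ∀ x ∈ (F \ Y) ∩ D, 1 ≤ p x ∧ p x - 1 ≤ q := by
    rintro x ⟨⟨hxF, -⟩, hxD⟩
    obtain ⟨y, ⟨hyΩ, hyY⟩, hxy⟩ := hDy x hxD
    refine ⟨hp1 x (hFΩ hxF), ?_⟩
    have := logq hc hp (hFΩ hxF) hyΩ hδ hxy.le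
    have hy1 : p y = 1 := hyY
    rw [hy1] at this
    exact (le_abs_self _).trans this
  have hDK : (F \ Y) ∩ D ⊆ K' := by
    rintro x ⟨⟨hxF, -⟩, hxD⟩
    obtain ⟨y, ⟨hyΩ, hyY⟩, hxy⟩ := hDy x hxD
    apply Metric.thickening_subset_cthickening
    by_contra hcon
    have : y ∈ W := hsW (Metric.closedBall_subset_cthickening
      (show x ∈ F \ Metric.thickening (r / 4) (F ∩ Y) from ⟨hxF, hcon⟩) s (by
        rw [Metric.mem_closedBall, dist_comm]; linarith))
    exact this.2 hyY
  have hX : ∀ x ∈ (F \ Y) \ D, Metric.closedBall x δ ⊆ W := by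
    rintro x ⟨⟨hxF, -⟩, hxD⟩ y hy
    refine ⟨hball x hxF hy, fun hyY => hxD ?_⟩
    refine Metric.infEDist_lt_iff.2 ⟨y, ⟨hball x hxF hy, hyY⟩, ?_⟩
    rw [edist_dist, ENNReal.ofReal_lt_ofReal_iff (by positivity), dist_comm]
    rw [Metric.mem_closedBall] at hy
    linarith
  have hXpt : ∀ x ∈ (F \ Y) \ D, ‖fderiv ℝ (Mo κ h) x‖ ^ p x ≤
      min ((Mo κ N x) ^ p x) (2 * Real.exp (n * c) * Mo κ hR x) := by
    intro x hx
    have hxW := hX x hx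
    have hxΩ : x ∈ Ω := hFΩ hx.1.1
    have h1 : ‖fderiv ℝ (Mo κ h) x‖ ^ p x ≤ (Mo κ N x) ^ p x :=
      Real.rpow_le_rpow (norm_nonneg _)
        (sob hκ hhi hW (fun x hx => hhu x hx.1) hG hGi hxW) (by linarith [hp1 x hxΩ])
    refine le_min h1 (h1.trans ?_)
    have hi2 : 1 ≤ (δ ^ n)⁻¹ := (one_le_inv₀ (by positivity)).2 (pow_le_one₀ hδ.le hδ1.le)
    have hA : Mo κ N x ≤ (1 + B * ∫ y, N y) * (δ ^ n)⁻¹ := by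
      calc Mo κ N x ≤ ∫ y, B * (δ ^ n)⁻¹ * N y := by
            refine integral_mono (Mo_integrand_integrable hκ hNi x) (hNi.const_mul _) fun y => ?_
            exact mul_le_mul_of_nonneg_right (hB δ hδ _) (hN0 y)
        _ = B * (δ ^ n)⁻¹ * ∫ y, N y := integral_const_mul _ _
        _ ≤ _ := by nlinarith
    refine (X_pt hκ hNi hN0 hRi hR0 hNR (fun x hx => hp1 x hx.1)
      (hxW (Metric.mem_closedBall_self hδ.le)) hxW hq0
      (one_le_mul_of_one_le_of_one_le (by nlinarith) hi2) ?_ hA).trans ?_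
    · intro y hy
      refine logq hc hp hxΩ (hxW hy).1 hδ ?_
      rw [Metric.mem_closedBall, dist_comm] at hy
      linarith
    · exact mul_le_mul_of_nonneg_right EX (Mo_nonneg hκ hR0 x)
  have hXint : ∫⁻ x in (F \ Y) \ D, ENNReal.ofReal (‖fderiv ℝ (Mo κ h) x‖ ^ p x) ≤
      (∫⁻ x in F \ Y, ENNReal.ofReal (‖g x‖ ^ p x)) + ENNReal.ofReal ε := by
    refine (setLIntegral_mono' (hFYm.diff hDm) fun x hx =>
      ENNReal.ofReal_le_ofReal (hXpt x hx)).trans ?_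
    refine (lintegral_mono_set diff_subset).trans (ED.trans ?_)
    gcongr
  have hNint := EN ((F \ Y) ∩ D) (hFYm.inter hDm) hDK hDN
  unfold hhlModularSmooth
  refine add_le_add ?_ ?_
  · refine le_trans ?_ hUT.le
    rw [← hTU]
    refine le_trans ?_ (Mo_tv_le hκ hhi hVU')
    exact iInf₂_le V ⟨hVo, hKV, hVsU.trans hUΩ⟩
  · rw [← lintegral_inter_add_diff _ (F \ Y) hDm]
    refine add_le_add (hNint.trans ?_) hXint
    rw [hTU]
    gcongr

end Helpers

/-- for bounded `Ω` and log-Hölder continuous `p`, for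
`u ∈ BV^{p(·)}(Ω)` (with weak gradient `g` on the Sobolev part), a closed set
`F ⊆ Ω` and standard mollifications `u_δ`, one has
`limsup_{δ→0⁺} ρ_{BV^{p(·)}(F)}(u_δ) ≤ C ρ_{BV^{p(·)}(F)}(u)` with a constant
`1 ≤ C < ∞` depending only on the log-Hölder constant of `p`. -/
theorem hhlModular_mollify_limsup_le :
    ∀ c : ℝ, 0 < c → ∃ C : ℝ, 1 ≤ C ∧
      ∀ (n : ℕ) (Ω : Set (Eu n)) (p : Eu n → ℝ) (u : Eu n → ℝ) (g : Eu n → Eu n)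
        (F : Set (Eu n)) (φ : Eu n → ℝ),
        IsOpen Ω → Bornology.IsBounded Ω →
        Measurable p → (∀ x ∈ Ω, 1 ≤ p x) → (∃ M : ℝ, ∀ x ∈ Ω, p x ≤ M) →
        LogHolderOn c Ω p →
        MemLpVar p Ω u → IsWeakGrad (Ω \ {x | p x = 1}) u g →
        hhlModular p Ω Ω u g < ⊤ →
        IsClosed F → F ⊆ Ω →
        ContDiff ℝ (⊤ : ℕ∞) φ → (∀ x, 0 ≤ φ x) → tsupport φ ⊆ Metric.closedBall 0 1 →
        (∫ x, φ x) = 1 →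
        Filter.limsup (fun δ : ℝ => hhlModularSmooth p Ω F (mollify Ω u φ δ))
            (𝓝[>] (0 : ℝ)) ≤
          ENNReal.ofReal C * hhlModular p Ω F u g := by

  intro c hc
  refine ⟨1 + 2 * Real.exp c, by have := Real.exp_pos c; linarith, ?_⟩
  intro n Ω p u g F φ hΩ hΩb hpm hp1 _ hp hu hg hfin hF hFΩ hφs hφ0 hφt hφi
  have hφ : IsKer φ 1 := by
    refine ⟨hφs, hφ0, fun x hx => ?_, hφi⟩
    refine image_eq_zero_of_notMem_tsupport fun hc => ?_
    have := hφt hc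
    rw [mem_closedBall_zero_iff] at this
    linarith
  by_cases hT : totVarIn Ω (F ∩ {x | p x = 1}) u = ⊤
  · have : hhlModular p Ω F u g = ⊤ := by simp [hhlModular, hT]
    rw [this, ENNReal.mul_top]
    · exact le_top
    · have := Real.exp_pos c
      simp only [ne_eq, ENNReal.ofReal_eq_zero, not_le]
      positivity
  refine ENNReal.le_of_forall_pos_le_add fun ε hε _ => ?_
  have hex := Real.exp_pos c
  set e : ℝ := ε / (3 + 2 * Real.exp c) with he
  have he0 : 0 < e := by have : (0 : ℝ) < ε := hε; positivity
  refine limsup_le_of_le (by isBoundedDefault) ?_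
  filter_upwards [mainE hc hΩ hΩb hpm hp1 hp hu hg hfin hF hFΩ hφ hT he0] with δ h
  rw [mollify_eq_Mo hΩ.measurableSet]
  refine h.trans ?_
  unfold hhlModular
  set T := totVarIn Ω (F ∩ {x | p x = 1}) u
  set I := ∫⁻ x in F \ {x | p x = 1}, ENNReal.ofReal (‖g x‖ ^ p x)
  have e1 : ENNReal.ofReal (1 + 2 * Real.exp c) = 1 + ENNReal.ofReal (2 * Real.exp c) := by
    rw [ENNReal.ofReal_add (by norm_num) (by positivity), ENNReal.ofReal_one]
  have e2 : (ε : ℝ≥0∞) = (3 + ENNReal.ofReal (2 * Real.exp c)) * ENNReal.ofReal e := by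
    have : (3 : ℝ≥0∞) = ENNReal.ofReal 3 := by simp
    rw [this, ← ENNReal.ofReal_add (by norm_num) (by positivity),
      ← ENNReal.ofReal_mul (by positivity), he, mul_div_cancel₀ _ (by positivity)]
    simp
  rw [e1, e2]
  set L := ENNReal.ofReal (2 * Real.exp c)
  set E := ENNReal.ofReal e
  calc T + E + (L * (T + E) + E + (I + E)) = ((1 + L) * T + I) + (3 + L) * E := by ring
    _ ≤ ((1 + L) * T + (1 + L) * I) + (3 + L) * E := by
        gcongr
        calc I = 1 * I := (one_mul I).symm
          _ ≤ (1 + L) * I := by gcongr; exact le_self_add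
    _ = _ := by ring
end
end
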